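/- arXiv:1708.01780 — 2 statements merged into one kernel-verified Lean document; each statement's English description precedes it below -/
import Mathlib

section
/- Let R be a commutative unital ring, E a directed graph, and H a hereditary subset of E^0 such that the restricted graph (E^0\H, r_E^{-1}(E^0\H)) is finite and acyclic, every vertex v in E^0\H admits a path from v to some vertex of H, and the set of edges with source in E^0\H and range in H is finite. Then the Leavitt path algebra L_R(E) is isomorphic to the Leavitt path algebra L_R(E(H)), where E(H) is the graph with vertex set H ∪ F(H), F(H) being the set of paths α = e_1⋯e_n in E with s(e_n) ∉ H and r(e_n) ∈ H, edge set s_E^{-1}(H) ∪ {ᾱ : α ∈ F(H)}, edges of s_E^{-1}(H) keeping their source and range, and each ᾱ having source α and range r_E(α). -/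
noncomputable section

structure DGraph : Type 1 where
  V : Type
  E : Type
  s : E → V
  r : E → V

namespace DGraph

variable (R : Type) [CommRing R]

inductive Gen (G : DGraph) : Type
  | vert : G.V → Gen G
  | edge : G.E → Gen G
  | ghost : G.E → Gen G

abbrev FA (G : DGraph) := FreeAlgebra R (Gen G)

def gv (G : DGraph) (v : G.V) : FA R G := FreeAlgebra.ι R (Gen.vert v)
def ge (G : DGraph) (e : G.E) : FA R G := FreeAlgebra.ι R (Gen.edge e)
def gg (G : DGraph) (e : G.E) : FA R G := FreeAlgebra.ι R (Gen.ghost e)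

/-- A vertex is regular if it emits a finite nonzero number of edges. -/
def IsRegular (G : DGraph) (v : G.V) : Prop :=
  {e : G.E | G.s e = v}.Finite ∧ {e : G.E | G.s e = v}.Nonempty

open Classical in
/-- The Leavitt path algebra relations. -/
inductive LRel (G : DGraph) : FA R G → FA R G → Prop
  | vmul (u v : G.V) : LRel G (gv R G u * gv R G v) (if u = v then gv R G u else 0)
  | se (e : G.E) : LRel G (gv R G (G.s e) * ge R G e) (ge R G e)
  | er (e : G.E) : LRel G (ge R G e * gv R G (G.r e)) (ge R G e)
  | rg (e : G.E) : LRel G (gv R G (G.r e) * gg R G e) (gg R G e)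
  | gs (e : G.E) : LRel G (gg R G e * gv R G (G.s e)) (gg R G e)
  | ck1 (e f : G.E) : LRel G (gg R G e * ge R G f) (if e = f then gv R G (G.r e) else 0)
  | ck2 (v : G.V) (h : IsRegular G v) :
      LRel G (h.1.toFinset.sum fun e => ge R G e * gg R G e) (gv R G v)

/-- The Leavitt path algebra of the graph `G` over `R`. -/
abbrev LPA (G : DGraph) : Type := RingQuot (LRel R G)

def Vq (G : DGraph) (v : G.V) : LPA R G := RingQuot.mkAlgHom R (LRel R G) (gv R G v)
def Eq' (G : DGraph) (e : G.E) : LPA R G := RingQuot.mkAlgHom R (LRel R G) (ge R G e)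
def Gq (G : DGraph) (e : G.E) : LPA R G := RingQuot.mkAlgHom R (LRel R G) (gg R G e)

def Step (G : DGraph) (v w : G.V) : Prop := ∃ e : G.E, G.s e = v ∧ G.r e = w
def Reaches (G : DGraph) : G.V → G.V → Prop := Relation.ReflTransGen (Step G)
def Hereditary (G : DGraph) (H : Set G.V) : Prop := ∀ v ∈ H, ∀ w, Reaches G v w → w ∈ H
def HClosure (G : DGraph) (X : Set G.V) : Set G.V := {w | ∃ v ∈ X, Reaches G v w}

def NoSinks (G : DGraph) : Prop := ∀ v : G.V, ∃ e, G.s e = v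
def NoSources (G : DGraph) : Prop := ∀ v : G.V, ∃ e, G.r e = v
def FiniteGraph (G : DGraph) : Prop := Finite G.V ∧ Finite G.E

/-- `A` is (isomorphic to) an algebraic Cuntz–Krieger `R`-algebra. -/
def IsCKAlgebra (A : Type) [Ring A] [Algebra R A] : Prop :=
  ∃ G : DGraph, FiniteGraph G ∧ NoSinks G ∧ NoSources G ∧ Nonempty (LPA R G ≃ₐ[R] A)

end DGraph

open DGraph

/-- `F(H)`: paths `α = e₁⋯eₙ` with `s(eₙ) ∉ H` and `r(eₙ) ∈ H`, stored as
(initial segment, last edge). -/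
def FH (G : DGraph) (H : Set G.V) : Type :=
  {p : List G.E × G.E //
    List.Chain' (fun e f => G.r e = G.s f) (p.1 ++ [p.2]) ∧ G.s p.2 ∉ H ∧ G.r p.2 ∈ H}

/-- The graph `E(H)` of Definition 3.1. -/
def graphEH (G : DGraph) (H : Set G.V) (hH : ∀ e : G.E, G.s e ∈ H → G.r e ∈ H) : DGraph where
  V := {v : G.V // v ∈ H} ⊕ FH G H
  E := {e : G.E // G.s e ∈ H} ⊕ FH G H
  s := Sum.elim (fun e => Sum.inl ⟨G.s e.1, e.2⟩) Sum.inr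
  r := Sum.elim (fun e => Sum.inl ⟨G.r e.1, hH e.1 e.2⟩)
    (fun a => Sum.inl ⟨G.r a.1.2, a.2.2.2⟩)

namespace DGraph

/-- A Leavitt `G`-family in a ring: elements satisfying the defining relations of the
Leavitt path algebra of `G`. -/
structure IsLeavittFamily (G : DGraph) {B : Type} [Ring B] (V : G.V → B) (E F : G.E → B) :
    Prop where
  vert_mul_self : ∀ v, V v * V v = V v
  vert_mul_of_ne : ∀ u v, u ≠ v → V u * V v = 0
  source_mul : ∀ e, V (G.s e) * E e = E e
  mul_range : ∀ e, E e * V (G.r e) = E e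
  range_mul : ∀ e, V (G.r e) * F e = F e
  mul_source : ∀ e, F e * V (G.s e) = F e
  ghost_mul_self : ∀ e, F e * E e = V (G.r e)
  ghost_mul_of_ne : ∀ e f, e ≠ f → F e * E f = 0
  sum_edge_mul_ghost : ∀ v (S : Finset G.E), (∀ e, e ∈ S ↔ G.s e = v) → S.Nonempty →
    ∑ e ∈ S, E e * F e = V v

variable (R : Type) [CommRing R]

theorem isLeavittFamily_LPA (G : DGraph) : IsLeavittFamily G (Vq R G) (Eq' R G) (Gq R G) where
  vert_mul_self v := by
    have := RingQuot.mkAlgHom_rel R (LRel.vmul (R := R) v v)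
    simpa [Vq] using this
  vert_mul_of_ne u v h := by
    have := RingQuot.mkAlgHom_rel R (LRel.vmul (R := R) u v)
    simpa [Vq, h] using this
  source_mul e := by
    have := RingQuot.mkAlgHom_rel R (LRel.se (R := R) e)
    simpa [Vq, Eq'] using this
  mul_range e := by
    have := RingQuot.mkAlgHom_rel R (LRel.er (R := R) e)
    simpa [Vq, Eq'] using this
  range_mul e := by
    have := RingQuot.mkAlgHom_rel R (LRel.rg (R := R) e)
    simpa [Vq, Gq] using this
  mul_source e := by
    have := RingQuot.mkAlgHom_rel R (LRel.gs (R := R) e)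
    simpa [Vq, Gq] using this
  ghost_mul_self e := by
    have := RingQuot.mkAlgHom_rel R (LRel.ck1 (R := R) e e)
    simpa [Vq, Eq', Gq] using this
  ghost_mul_of_ne e f h := by
    have := RingQuot.mkAlgHom_rel R (LRel.ck1 (R := R) e f)
    simpa [Eq', Gq, h] using this
  sum_edge_mul_ghost v S hS hne := by
    have hreg : IsRegular G v :=
      ⟨S.finite_toSet.subset fun e he => (hS e).2 he, hne.imp fun e he => (hS e).1 he⟩
    have hS' : hreg.1.toFinset = S := by ext e; simp [hS]
    have := RingQuot.mkAlgHom_rel R (LRel.ck2 (R := R) v hreg)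
    simpa [Vq, Eq', Gq, hS'] using this

variable {R}

theorem IsLeavittFamily.exists_lift {G : DGraph} {B : Type} [Ring B] [Algebra R B]
    {V : G.V → B} {E F : G.E → B} (h : IsLeavittFamily G V E F) :
    ∃ f : LPA R G →ₐ[R] B, (∀ v, f (Vq R G v) = V v) ∧ (∀ e, f (Eq' R G e) = E e) ∧
      ∀ e, f (Gq R G e) = F e := by
  let gen : Gen G → B := fun g => match g with
    | .vert v => V v
    | .edge e => E e
    | .ghost e => F e
  have hv : ∀ v, FreeAlgebra.lift R gen (gv R G v) = V v := fun v => by simp [gv, gen]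
  have he : ∀ e, FreeAlgebra.lift R gen (ge R G e) = E e := fun v => by simp [ge, gen]
  have hg : ∀ e, FreeAlgebra.lift R gen (gg R G e) = F e := fun v => by simp [gg, gen]
  refine ⟨RingQuot.liftAlgHom R ⟨FreeAlgebra.lift R gen, ?_⟩, ?_, ?_, ?_⟩
  · intro x y hxy
    induction hxy with
    | vmul u v =>
      by_cases huv : u = v
      · subst huv; simp [hv, h.vert_mul_self]
      · simp [hv, huv, h.vert_mul_of_ne u v huv]
    | se e => simp [hv, he, h.source_mul]
    | er e => simp [hv, he, h.mul_range]
    | rg e => simp [hv, hg, h.range_mul]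
    | gs e => simp [hv, hg, h.mul_source]
    | ck1 e f =>
      by_cases hef : e = f
      · subst hef; simp [hv, he, hg, h.ghost_mul_self]
      · simp [he, hg, hef, h.ghost_mul_of_ne e f hef]
    | ck2 v hreg =>
      simp only [map_sum, map_mul, he, hg, hv]
      exact h.sum_edge_mul_ghost v _ (by simp) (by simpa using hreg.2)
  · intro v; simp [Vq, hv]
  · intro e; simp [Eq', he]
  · intro e; simp [Gq, hg]

theorem LPA_hom_ext {G : DGraph} {B : Type} [Ring B] [Algebra R B] {f g : LPA R G →ₐ[R] B}
    (hv : ∀ v, f (Vq R G v) = g (Vq R G v)) (he : ∀ e, f (Eq' R G e) = g (Eq' R G e))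
    (hg : ∀ e, f (Gq R G e) = g (Gq R G e)) : f = g := by
  apply RingQuot.ringQuot_ext'
  apply FreeAlgebra.hom_ext
  funext x
  cases x with
  | vert v => exact hv v
  | edge e => exact he e
  | ghost e => exact hg e

end DGraph

namespace HPath

/-- The paths of `G` that end as soon as they enter `H`; those of length zero are the
vertices of `H`. They are the vertices of `graphEH`. -/
abbrev _root_.HPath (G : DGraph) (H : Set G.V) : Type := {v : G.V // v ∈ H} ⊕ FH G H

variable {G : DGraph} {H : Set G.V}

/-- The source of a path. -/
def src : HPath G H → G.V
  | .inl v => v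
  | .inr a => G.s ((a.1.1 ++ [a.1.2]).head (by simp))

/-- The range of a path, an element of `H`. -/
def rng : HPath G H → {v : G.V // v ∈ H}
  | .inl v => v
  | .inr a => ⟨G.r a.1.2, a.2.2.2⟩

theorem chain_cons {e : G.E} {a : FH G H} (h : src (Sum.inr a : HPath G H) = G.r e) :
    List.IsChain (fun e f => G.r e = G.s f) (e :: (a.1.1 ++ [a.1.2])) := by
  rw [List.isChain_cons]
  refine ⟨?_, a.2.1⟩
  intro y hy
  rw [List.head?_eq_some_head (by simp)] at hy
  simp only [Option.mem_def, Option.some.injEq] at hy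
  subst hy
  exact h.symm

open Classical in
/-- The path `e p`, when `s e ∉ H` and `p` starts at `r e` (a junk value otherwise). -/
def cons (e : G.E) (p : HPath G H) : HPath G H :=
  if h : G.s e ∉ H ∧ src p = G.r e then
    .inr <| match p, h with
      | .inl v, h => ⟨([], e), List.isChain_singleton _, h.1, h.2 ▸ v.2⟩
      | .inr a, h => ⟨(e :: a.1.1, a.1.2), chain_cons h.2, a.2.2⟩
  else p

theorem cons_inl {e : G.E} {v : {v : G.V // v ∈ H}} (he : G.s e ∉ H) (hv : v.1 = G.r e) :
    cons e (Sum.inl v) = Sum.inr ⟨([], e), List.isChain_singleton _, he, hv ▸ v.2⟩ := by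
  have : G.s e ∉ H ∧ src (Sum.inl v : HPath G H) = G.r e := ⟨he, hv⟩
  rw [cons, dif_pos this]

theorem cons_inr {e : G.E} {a : FH G H} (he : G.s e ∉ H)
    (ha : src (Sum.inr a : HPath G H) = G.r e) :
    cons e (Sum.inr a) = Sum.inr ⟨(e :: a.1.1, a.1.2), chain_cons ha, a.2.2⟩ := by
  have : G.s e ∉ H ∧ src (Sum.inr a : HPath G H) = G.r e := ⟨he, ha⟩
  rw [cons, dif_pos this]

theorem src_cons {e : G.E} {p : HPath G H} (he : G.s e ∉ H) (hp : src p = G.r e) :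
    src (cons e p) = G.s e := by
  cases p with
  | inl v => rw [cons_inl he hp]; rfl
  | inr a => rw [cons_inr he hp]; rfl

theorem rng_cons {e : G.E} {p : HPath G H} (he : G.s e ∉ H) (hp : src p = G.r e) :
    rng (cons e p) = rng p := by
  cases p with
  | inl v => rw [cons_inl he hp]; exact Subtype.ext hp.symm
  | inr a => rw [cons_inr he hp]; rfl

theorem cons_injective {e f : G.E} {p q : HPath G H} (he : G.s e ∉ H) (hp : src p = G.r e)
    (hf : G.s f ∉ H) (hq : src q = G.r f) (h : cons e p = cons f q) : e = f ∧ p = q := by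
  cases p with
  | inl v =>
    cases q with
    | inl w =>
      rw [cons_inl he hp, cons_inl hf hq] at h
      have hef : e = f := congrArg (fun a : FH G H => a.1.2) (Sum.inr_injective h)
      exact ⟨hef, congrArg _ (Subtype.ext (hp.trans ((congrArg G.r hef).trans hq.symm)))⟩
    | inr b =>
      rw [cons_inl he hp, cons_inr hf hq] at h
      have h := congrArg Subtype.val (Sum.inr_injective h)
      simp at h
  | inr a =>
    cases q with
    | inl w =>
      rw [cons_inr he hp, cons_inl hf hq] at h
      have h := congrArg Subtype.val (Sum.inr_injective h)
      simp at h
    | inr b =>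
      rw [cons_inr he hp, cons_inr hf hq] at h
      have h := congrArg Subtype.val (Sum.inr_injective h)
      simp only [Prod.mk.injEq, List.cons.injEq] at h
      exact ⟨h.1.1, congrArg _ (Subtype.ext (Prod.ext h.1.2 h.2))⟩

/-- Every path of positive length arises by prefixing an edge. -/
theorem exists_eq_cons (h' : ∀ e : G.E, G.s e ∈ H → G.r e ∈ H) (a : FH G H) :
    ∃ e p, G.s e ∉ H ∧ src p = G.r e ∧ (Sum.inr a : HPath G H) = cons e p ∧
      (∀ b, p = Sum.inr b → b.1.1.length < a.1.1.length) := by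
  obtain ⟨⟨l, e⟩, hc, hs, hr⟩ := a
  cases l with
  | nil =>
    exact ⟨e, Sum.inl ⟨G.r e, hr⟩, hs, rfl, (cons_inl hs rfl).symm, by simp⟩
  | cons f l =>
    have hc' : List.IsChain (fun e f => G.r e = G.s f) (f :: (l ++ [e])) := hc
    rw [List.isChain_cons] at hc'
    let b : FH G H := ⟨(l, e), hc'.2, hs, hr⟩
    have hb : src (Sum.inr b : HPath G H) = G.r f :=
      (hc'.1 _ (List.head?_eq_some_head (by simp))).symm
    have hf : G.s f ∉ H := by
      have key : ∀ (l : List G.E) (f : G.E),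
          List.IsChain (fun e f => G.r e = G.s f) (f :: (l ++ [e])) → G.s f ∉ H := by
        intro l
        induction l with
        | nil =>
          intro f hc hf
          have : G.r f = G.s e := by simpa using hc
          exact hs (this ▸ h' f hf)
        | cons g l ih =>
          intro f hc hf
          have hc2 : G.r f = G.s g ∧ List.IsChain (fun e f => G.r e = G.s f) (g :: (l ++ [e])) := by
            simpa using hc
          exact ih g hc2.2 (hc2.1 ▸ h' f hf)
      exact key l f hc
    refine ⟨f, Sum.inr b, hf, hb, (cons_inr hf hb).symm, ?_⟩
    rintro c hcb
    cases hcb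
    simp [b]

theorem cons_induction (h' : ∀ e : G.E, G.s e ∈ H → G.r e ∈ H) {P : HPath G H → Prop}
    (inl : ∀ v, P (Sum.inl v))
    (cons : ∀ e p, G.s e ∉ H → src p = G.r e → P p → P (cons e p)) (p : HPath G H) : P p := by
  cases p with
  | inl v => exact inl v
  | inr a =>
    induction hn : a.1.1.length using Nat.strong_induction_on generalizing a with
    | _ n ih =>
      obtain ⟨e, p, he, hp, hap, hlt⟩ := exists_eq_cons h' a
      rw [hap]
      refine cons e p he hp ?_
      cases p with
      | inl v => exact inl v
      | inr b => exact ih _ (hn ▸ hlt b rfl) b rfl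

theorem src_inr_notMem (h' : ∀ e : G.E, G.s e ∈ H → G.r e ∈ H) (a : FH G H) :
    src (Sum.inr a : HPath G H) ∉ H := by
  obtain ⟨e, p, he, hp, hap, -⟩ := exists_eq_cons h' a
  rw [hap, src_cons he hp]
  exact he

theorem src_eq_iff_of_mem (h' : ∀ e : G.E, G.s e ∈ H → G.r e ∈ H) (v : {v : G.V // v ∈ H})
    (p : HPath G H) : src p = v.1 ↔ p = Sum.inl v := by
  cases p with
  | inl w => exact ⟨fun h => congrArg _ (Subtype.ext h), fun h => by cases h; rfl⟩
  | inr a => exact ⟨fun h => absurd (h ▸ v.2) (src_inr_notMem h' a), fun h => by cases h⟩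

/-- Outside `H`, acyclicity and finiteness allow induction along edges. -/
theorem vertex_induction (hfinV : Finite {v : G.V // v ∉ H})
    (hacyc : ∀ (l : List G.E) (hl : l ≠ []), List.IsChain (fun e f => G.r e = G.s f) l →
      (∀ e ∈ l, G.r e ∉ H) → G.r (l.getLast hl) ≠ G.s (l.head hl))
    {P : G.V → Prop} (mem : ∀ v ∈ H, P v)
    (step : ∀ v, v ∉ H → (∀ e, G.s e = v → P (G.r e)) → P v) (v : G.V) : P v := by
  let S : {v : G.V // v ∉ H} → {v : G.V // v ∉ H} → Prop := fun w v => Step G v.1 w.1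
  have hlist : ∀ w v, Relation.TransGen S w v → ∃ (l : List G.E) (hl : l ≠ []),
      List.IsChain (fun e f => G.r e = G.s f) l ∧ (∀ e ∈ l, G.r e ∉ H) ∧
      G.r (l.getLast hl) = w ∧ G.s (l.head hl) = v := by
    intro w v h
    induction h with
    | single h =>
      obtain ⟨e, hs, hr⟩ := h
      exact ⟨[e], by simp, by simp, by simpa [hr] using w.2, hr, hs⟩
    | @tail b c _ h ih =>
      obtain ⟨e, hs, hr⟩ := h
      obtain ⟨l, hl, hc, hm, hlast, hhead⟩ := ih
      refine ⟨e :: l, by simp, ?_, ?_, ?_, hs⟩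
      · rw [List.isChain_cons]
        refine ⟨?_, hc⟩
        intro y hy
        rw [List.head?_eq_some_head hl] at hy
        simp only [Option.mem_def, Option.some.injEq] at hy
        rw [← hy, hr, hhead]
      · intro f hf
        rcases List.mem_cons.1 hf with rfl | hf
        · rw [hr]; exact b.2
        · exact hm f hf
      · rw [List.getLast_cons hl, hlast]
  have hirr : Std.Irrefl (Relation.TransGen S) := ⟨fun v h => by
    obtain ⟨l, hl, hc, hm, hlast, hhead⟩ := hlist v v h
    exact hacyc l hl hc hm (hlast.trans hhead.symm)⟩
  have hwf : WellFounded (Relation.TransGen S) := Finite.wellFounded_of_trans_of_irrefl _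
  by_cases hv : v ∈ H
  · exact mem v hv
  · suffices ∀ w : {v : G.V // v ∉ H}, P w.1 from this ⟨v, hv⟩
    intro w
    induction w using hwf.induction with
    | _ w ih =>
      refine step w.1 w.2 fun e he => ?_
      by_cases hr : G.r e ∈ H
      · exact mem _ hr
      · exact ih ⟨G.r e, hr⟩ (.single ⟨e, he, rfl⟩)

theorem finite_src_eq (h' : ∀ e : G.E, G.s e ∈ H → G.r e ∈ H)
    (hind : ∀ P : G.V → Prop, (∀ v ∈ H, P v) →
      (∀ v, v ∉ H → (∀ e, G.s e = v → P (G.r e)) → P v) → ∀ v, P v)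
    (hout : ∀ v, v ∉ H → {e | G.s e = v}.Finite) (v : G.V) :
    {p : HPath G H | src p = v}.Finite := by
  refine hind (fun v => {p : HPath G H | src p = v}.Finite) ?_ ?_ v
  · intro v hv
    refine (Set.finite_singleton (Sum.inl ⟨v, hv⟩)).subset fun p hp => ?_
    exact (src_eq_iff_of_mem h' ⟨v, hv⟩ p).1 hp
  · intro v hv ih
    refine ((hout v hv).biUnion (t := fun e => cons e '' {p : HPath G H | src p = G.r e})
      fun e he => (ih e he).image _).subset fun p hp => ?_
    cases p with
    | inl w => exact absurd (hp ▸ w.2 : v ∈ H) hv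
    | inr a =>
      obtain ⟨e, p, he, hep, hap, -⟩ := exists_eq_cons h' a
      rw [hap] at hp ⊢
      change src (cons e p) = v at hp
      rw [src_cons he hep] at hp
      exact Set.mem_biUnion hp ⟨p, hep, rfl⟩

/-- Summing over the paths from `v ∉ H` by their first edge. -/
theorem sum_eq_sum_cons {M : Type} [AddCommMonoid M] (h' : ∀ e : G.E, G.s e ∈ H → G.r e ∈ H)
    {fib : G.V → Finset (HPath G H)} (hfib : ∀ v p, p ∈ fib v ↔ src p = v) {v : G.V}
    (hv : v ∉ H) {S : Finset G.E} (hS : ∀ e, e ∈ S ↔ G.s e = v) (f : HPath G H → M) :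
    ∑ p ∈ fib v, f p = ∑ e ∈ S, ∑ p ∈ fib (G.r e), f (cons e p) := by
  rw [Finset.sum_sigma']
  symm
  refine Finset.sum_bij (fun x _ => cons x.1 x.2) ?_ ?_ ?_ (fun _ _ => rfl)
  · rintro ⟨e, p⟩ h
    simp only [Finset.mem_sigma, hS, hfib] at h ⊢
    rw [src_cons (h.1 ▸ hv) h.2, h.1]
  · rintro ⟨e, p⟩ h ⟨f, q⟩ k hpq
    simp only [Finset.mem_sigma, hS, hfib] at h k
    obtain ⟨rfl, rfl⟩ := cons_injective (h.1 ▸ hv) h.2 (k.1 ▸ hv) k.2 hpq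
    rfl
  · intro p hp
    rw [hfib] at hp
    cases p with
    | inl w => exact absurd (hp ▸ w.2 : v ∈ H) hv
    | inr a =>
      obtain ⟨e, p, he, hep, hap, -⟩ := exists_eq_cons h' a
      rw [hap, src_cons he hep] at hp
      exact ⟨⟨e, p⟩, by simp [hS, hfib, hp, hep], hap.symm⟩

section LeavittFamilies

variable {A : Type} [Ring A]

/-- The product along a path of the edges of a Leavitt family. -/
def pathEdge (V : G.V → A) (E : G.E → A) : HPath G H → A
  | .inl v => V v
  | .inr a => (a.1.1.map E).prod * E a.1.2

/-- The product along a reversed path of the ghost edges of a Leavitt family. -/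
def pathGhost (V : G.V → A) (F : G.E → A) : HPath G H → A
  | .inl v => V v
  | .inr a => F a.1.2 * (a.1.1.reverse.map F).prod

variable {V : G.V → A} {E F : G.E → A}

theorem pathEdge_cons (h : IsLeavittFamily G V E F) {e : G.E} {p : HPath G H}
    (he : G.s e ∉ H) (hp : src p = G.r e) :
    pathEdge V E (cons e p) = E e * pathEdge V E p := by
  cases p with
  | inl v =>
    have hv : v.1 = G.r e := hp
    rw [cons_inl he hp]
    simp [pathEdge, hv, h.mul_range]
  | inr a =>
    rw [cons_inr he hp]
    simp [pathEdge, mul_assoc]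

theorem pathGhost_cons (h : IsLeavittFamily G V E F) {e : G.E} {p : HPath G H}
    (he : G.s e ∉ H) (hp : src p = G.r e) :
    pathGhost V F (cons e p) = pathGhost V F p * F e := by
  cases p with
  | inl v =>
    have hv : v.1 = G.r e := hp
    rw [cons_inl he hp]
    simp [pathGhost, hv, h.range_mul]
  | inr a =>
    rw [cons_inr he hp]
    simp [pathGhost, mul_assoc]

theorem src_mul_pathEdge (h' : ∀ e : G.E, G.s e ∈ H → G.r e ∈ H)
    (h : IsLeavittFamily G V E F) (p : HPath G H) :
    V (src p) * pathEdge V E p = pathEdge V E p := by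
  induction p using cons_induction h' with
  | inl v => exact h.vert_mul_self _
  | cons e p he hp _ => rw [src_cons he hp, pathEdge_cons h he hp, ← mul_assoc, h.source_mul]

theorem pathGhost_mul_src (h' : ∀ e : G.E, G.s e ∈ H → G.r e ∈ H)
    (h : IsLeavittFamily G V E F) (p : HPath G H) :
    pathGhost V F p * V (src p) = pathGhost V F p := by
  induction p using cons_induction h' with
  | inl v => exact h.vert_mul_self _
  | cons e p he hp _ => rw [src_cons he hp, pathGhost_cons h he hp, mul_assoc, h.mul_source]

theorem pathEdge_mul_rng (h' : ∀ e : G.E, G.s e ∈ H → G.r e ∈ H)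
    (h : IsLeavittFamily G V E F) (p : HPath G H) :
    pathEdge V E p * V (rng p) = pathEdge V E p := by
  induction p using cons_induction h' with
  | inl v => exact h.vert_mul_self _
  | cons e p he hp ih => rw [rng_cons he hp, pathEdge_cons h he hp, mul_assoc, ih]

theorem rng_mul_pathGhost (h' : ∀ e : G.E, G.s e ∈ H → G.r e ∈ H)
    (h : IsLeavittFamily G V E F) (p : HPath G H) :
    V (rng p) * pathGhost V F p = pathGhost V F p := by
  induction p using cons_induction h' with
  | inl v => exact h.vert_mul_self _
  | cons e p he hp ih => rw [rng_cons he hp, pathGhost_cons h he hp, ← mul_assoc, ih]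

theorem pathGhost_mul_pathEdge_of_src_ne (h' : ∀ e : G.E, G.s e ∈ H → G.r e ∈ H)
    (h : IsLeavittFamily G V E F) {p q : HPath G H} (hpq : src p ≠ src q) :
    pathGhost V F p * pathEdge V E q = 0 := by
  rw [← pathGhost_mul_src h' h p, ← src_mul_pathEdge h' h q, mul_assoc, ← mul_assoc (V _) (V _),
    h.vert_mul_of_ne _ _ hpq, zero_mul, mul_zero]

theorem pathGhost_mul_pathEdge_self (h' : ∀ e : G.E, G.s e ∈ H → G.r e ∈ H)
    (h : IsLeavittFamily G V E F) (p : HPath G H) :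
    pathGhost V F p * pathEdge V E p = V (rng p) := by
  induction p using cons_induction h' with
  | inl v => exact h.vert_mul_self _
  | cons e p he hp ih =>
    rw [pathEdge_cons h he hp, pathGhost_cons h he hp, mul_assoc, ← mul_assoc (F e),
      h.ghost_mul_self, ← hp, src_mul_pathEdge h' h, ih, rng_cons he hp]

theorem pathGhost_mul_pathEdge_of_ne (h' : ∀ e : G.E, G.s e ∈ H → G.r e ∈ H)
    (h : IsLeavittFamily G V E F) (p q : HPath G H) (hpq : p ≠ q) :
    pathGhost V F p * pathEdge V E q = 0 := by
  induction p using cons_induction h' generalizing q with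
  | inl v =>
    refine pathGhost_mul_pathEdge_of_src_ne h' h fun hs => hpq ?_
    exact ((src_eq_iff_of_mem h' v q).1 hs.symm).symm
  | cons e p he hp ih =>
    cases q using cons_induction h' with
    | inl v =>
      refine pathGhost_mul_pathEdge_of_src_ne h' h fun hs => hpq ?_
      exact (src_eq_iff_of_mem h' v _).1 hs
    | cons f q hf hq _ =>
      rw [pathEdge_cons h hf hq, pathGhost_cons h he hp, mul_assoc, ← mul_assoc (F e)]
      by_cases hef : e = f
      · subst hef
        rw [h.ghost_mul_self, ← hq, src_mul_pathEdge h' h]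
        exact ih q fun hpq' => hpq (by rw [hpq'])
      · rw [h.ghost_mul_of_ne _ _ hef, zero_mul, mul_zero]

/-- A reducible copy of `graphEH`, whose vertices are the paths in `HPath G H`. -/
abbrev pathGraph (G : DGraph) (H : Set G.V) (h' : ∀ e : G.E, G.s e ∈ H → G.r e ∈ H) :
    DGraph where
  V := HPath G H
  E := {e : G.E // G.s e ∈ H} ⊕ FH G H
  s := Sum.elim (fun e => Sum.inl ⟨G.s e.1, e.2⟩) Sum.inr
  r := Sum.elim (fun e => Sum.inl ⟨G.r e.1, h' e.1 e.2⟩) (fun a => Sum.inl (rng (Sum.inr a)))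

/-- A Leavitt family of `G` gives one of `pathGraph G H`, sending `ᾱ` to the product along `α`. -/
theorem isLeavittFamily_pathGraph (h' : ∀ e : G.E, G.s e ∈ H → G.r e ∈ H)
    (h : IsLeavittFamily G V E F) :
    IsLeavittFamily (pathGraph G H h') (fun p : HPath G H => pathEdge V E p * pathGhost V F p)
      (Sum.elim (fun e => E e.1) fun a => pathEdge V E (Sum.inr a : HPath G H))
      (Sum.elim (fun e => F e.1) fun a => pathGhost V F (Sum.inr a : HPath G H)) := by
  have hinl : ∀ v : {v : G.V // v ∈ H},
      pathEdge V E (Sum.inl v : HPath G H) * pathGhost V F (Sum.inl v : HPath G H) = V v :=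
    fun v => h.vert_mul_self v
  refine ⟨?_, ?_, ?_, ?_, ?_, ?_, ?_, ?_, ?_⟩
  · intro p
    rw [mul_assoc, ← mul_assoc (pathGhost V F p), pathGhost_mul_pathEdge_self h' h,
      rng_mul_pathGhost h' h]
  · intro p q hpq
    rw [mul_assoc, ← mul_assoc (pathGhost V F p), pathGhost_mul_pathEdge_of_ne h' h p q hpq,
      zero_mul, mul_zero]
  · rintro (e | a)
    · exact (congrArg (· * E e.1) (hinl ⟨G.s e.1, e.2⟩)).trans (h.source_mul _)
    · change pathEdge V E (Sum.inr a : HPath G H) * pathGhost V F (Sum.inr a : HPath G H) *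
        pathEdge V E (Sum.inr a : HPath G H) = pathEdge V E (Sum.inr a : HPath G H)
      rw [mul_assoc, pathGhost_mul_pathEdge_self h' h, pathEdge_mul_rng h' h]
  · rintro (e | a)
    · exact (congrArg (E e.1 * ·) (hinl ⟨G.r e.1, h' _ e.2⟩)).trans (h.mul_range _)
    · exact (congrArg (_ * ·) (hinl (rng (Sum.inr a)))).trans (pathEdge_mul_rng h' h (Sum.inr a))
  · rintro (e | a)
    · exact (congrArg (· * F e.1) (hinl ⟨G.r e.1, h' _ e.2⟩)).trans (h.range_mul _)
    · exact (congrArg (· * _) (hinl (rng (Sum.inr a)))).trans (rng_mul_pathGhost h' h (Sum.inr a))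
  · rintro (e | a)
    · exact (congrArg (F e.1 * ·) (hinl ⟨G.s e.1, e.2⟩)).trans (h.mul_source _)
    · change pathGhost V F (Sum.inr a : HPath G H) * (pathEdge V E (Sum.inr a : HPath G H) *
        pathGhost V F (Sum.inr a : HPath G H)) = pathGhost V F (Sum.inr a : HPath G H)
      rw [← mul_assoc, pathGhost_mul_pathEdge_self h' h, rng_mul_pathGhost h' h]
  · rintro (e | a)
    · exact (h.ghost_mul_self _).trans (hinl ⟨G.r e.1, h' _ e.2⟩).symm
    · exact (pathGhost_mul_pathEdge_self h' h (Sum.inr a)).trans (hinl (rng (Sum.inr a))).symm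
  · rintro (e | a) (f | b) hne
    · exact h.ghost_mul_of_ne _ _ fun hef => hne (congrArg _ (Subtype.ext hef))
    · change F e.1 * pathEdge V E (Sum.inr b : HPath G H) = 0
      have hs : G.s e.1 ≠ src (Sum.inr b : HPath G H) :=
        fun hs => src_inr_notMem h' b (hs ▸ e.2)
      rw [← h.mul_source, ← src_mul_pathEdge h' h, mul_assoc, ← mul_assoc (V _) (V _),
        h.vert_mul_of_ne _ _ hs, zero_mul, mul_zero]
    · change pathGhost V F (Sum.inr a : HPath G H) * E f.1 = 0
      have hs : src (Sum.inr a : HPath G H) ≠ G.s f.1 :=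
        fun hs => src_inr_notMem h' a (hs ▸ f.2)
      rw [← h.source_mul, ← pathGhost_mul_src h' h, mul_assoc, ← mul_assoc (V _) (V _),
        h.vert_mul_of_ne _ _ hs, zero_mul, mul_zero]
    · exact pathGhost_mul_pathEdge_of_ne h' h (Sum.inr a) (Sum.inr b)
        fun hab => hne (congrArg _ (Sum.inr_injective hab))
  · rintro (v | a) S hS hne
    · have hright : S.toRight = ∅ := by
        ext a
        simp only [Finset.mem_toRight, Finset.notMem_empty, iff_false]
        intro ha
        cases (hS (Sum.inr a)).1 ha
      have hmem : ∀ e, e ∈ S.toLeft.map (Function.Embedding.subtype _) ↔ G.s e = v.1 := by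
        intro e
        simp only [Finset.mem_map, Finset.mem_toLeft, Function.Embedding.subtype_apply]
        constructor
        · rintro ⟨e, he, rfl⟩
          exact congrArg Subtype.val (Sum.inl_injective ((hS (Sum.inl e)).1 he))
        · intro he
          exact ⟨⟨e, he ▸ v.2⟩, (hS (Sum.inl ⟨e, he ▸ v.2⟩)).2 (congrArg Sum.inl (Subtype.ext he)),
            rfl⟩
      have hne' : (S.toLeft.map (Function.Embedding.subtype _)).Nonempty := by
        obtain ⟨e | a, he⟩ := hne
        · exact ⟨e.1, Finset.mem_map_of_mem _ (Finset.mem_toLeft.2 he)⟩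
        · cases (hS (Sum.inr a)).1 he
      have hsum := h.sum_edge_mul_ghost v.1 _ hmem hne'
      rw [Finset.sum_map] at hsum
      rw [← Finset.toLeft_disjSum_toRight (u := S), hright]
      refine (Finset.sum_disjSum _ _ _).trans ?_
      rw [Finset.sum_empty, add_zero]
      exact hsum.trans (hinl v).symm
    · have hS' : S = {(Sum.inr a : (pathGraph G H h').E)} := by
        ext x
        rw [hS, Finset.mem_singleton]
        rcases x with e | b <;> simp
      rw [hS', Finset.sum_singleton]
      rfl

/-- In a Leavitt family of `G`, every vertex is the sum of the projections of the paths
issuing from it. -/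
theorem sum_pathEdge_mul_pathGhost (h' : ∀ e : G.E, G.s e ∈ H → G.r e ∈ H)
    (h : IsLeavittFamily G V E F)
    (hind : ∀ P : G.V → Prop, (∀ v ∈ H, P v) →
      (∀ v, v ∉ H → (∀ e, G.s e = v → P (G.r e)) → P v) → ∀ v, P v)
    {fib : G.V → Finset (HPath G H)} (hfib : ∀ v p, p ∈ fib v ↔ src p = v)
    (hreg : ∀ v, v ∉ H → IsRegular G v) (v : G.V) :
    ∑ p ∈ fib v, pathEdge V E p * pathGhost V F p = V v := by
  refine hind (fun v => ∑ p ∈ fib v, pathEdge V E p * pathGhost V F p = V v) ?_ ?_ v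
  · intro v hv
    have : fib v = {Sum.inl ⟨v, hv⟩} := by
      ext p
      rw [hfib, Finset.mem_singleton]
      exact src_eq_iff_of_mem h' ⟨v, hv⟩ p
    rw [this, Finset.sum_singleton]
    exact h.vert_mul_self v
  · intro v hv ih
    have hS : ∀ e, e ∈ (hreg v hv).1.toFinset ↔ G.s e = v := by simp
    rw [sum_eq_sum_cons h' hfib hv hS,
      ← h.sum_edge_mul_ghost v _ hS (by simpa using (hreg v hv).2)]
    refine Finset.sum_congr rfl fun e he => ?_
    have hes := (hS e).1 he
    have : ∀ p ∈ fib (G.r e), pathEdge V E (cons e p) * pathGhost V F (cons e p) =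
        E e * (pathEdge V E p * pathGhost V F p) * F e := by
      intro p hp
      rw [pathEdge_cons h (hes ▸ hv) ((hfib _ _).1 hp),
        pathGhost_cons h (hes ▸ hv) ((hfib _ _).1 hp)]
      simp only [mul_assoc]
    rw [Finset.sum_congr rfl this, ← Finset.sum_mul, ← Finset.mul_sum, ih e hes, h.mul_range]

end LeavittFamilies

section PathGraphFamilies

variable {h' : ∀ e : G.E, G.s e ∈ H → G.r e ∈ H} {B : Type} [Ring B]

/-- In a family indexed by `pathGraph`, the element of a path: a vertex or an edge `ᾱ`. -/
def toEdge (W : HPath G H → B) (E : {e : G.E // G.s e ∈ H} ⊕ FH G H → B) : HPath G H → B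
  | .inl v => W (.inl v)
  | .inr a => E (.inr a)

variable {W : HPath G H → B} {E F : {e : G.E // G.s e ∈ H} ⊕ FH G H → B}

theorem toEdge_mul_toEdge (h : IsLeavittFamily (pathGraph G H h') W E F) (p : HPath G H) :
    toEdge W E p * toEdge W F p = W p := by
  rcases p with v | a
  · exact h.vert_mul_self (Sum.inl v)
  · have := h.sum_edge_mul_ghost (Sum.inr a) {Sum.inr a}
      (by rintro (e | b) <;> simp) (Finset.singleton_nonempty _)
    rwa [Finset.sum_singleton] at this

theorem vert_mul_toEdge (h : IsLeavittFamily (pathGraph G H h') W E F) (p : HPath G H) :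
    W p * toEdge W E p = toEdge W E p := by
  rcases p with v | a
  · exact h.vert_mul_self (Sum.inl v)
  · exact h.source_mul (Sum.inr a)

theorem toEdge_mul_vert (h : IsLeavittFamily (pathGraph G H h') W E F) (p : HPath G H) :
    toEdge W F p * W p = toEdge W F p := by
  rcases p with v | a
  · exact h.vert_mul_self (Sum.inl v)
  · exact h.mul_source (Sum.inr a)

theorem toEdge_mul_rng (h : IsLeavittFamily (pathGraph G H h') W E F) (p : HPath G H) :
    toEdge W E p * W (Sum.inl (rng p)) = toEdge W E p := by
  rcases p with v | a
  · exact h.vert_mul_self (Sum.inl v)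
  · exact h.mul_range (Sum.inr a)

theorem rng_mul_toEdge (h : IsLeavittFamily (pathGraph G H h') W E F) (p : HPath G H) :
    W (Sum.inl (rng p)) * toEdge W F p = toEdge W F p := by
  rcases p with v | a
  · exact h.vert_mul_self (Sum.inl v)
  · exact h.range_mul (Sum.inr a)

theorem toEdge_mul_toEdge_self (h : IsLeavittFamily (pathGraph G H h') W E F)
    (p : HPath G H) : toEdge W F p * toEdge W E p = W (Sum.inl (rng p)) := by
  rcases p with v | a
  · exact h.vert_mul_self (Sum.inl v)
  · exact h.ghost_mul_self (Sum.inr a)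

theorem vert_mul_toEdge_of_ne (h : IsLeavittFamily (pathGraph G H h') W E F)
    {p q : HPath G H} (hpq : p ≠ q) : W p * toEdge W E q = 0 := by
  rw [← vert_mul_toEdge h q, ← mul_assoc, h.vert_mul_of_ne p q hpq, zero_mul]

theorem toEdge_mul_vert_of_ne (h : IsLeavittFamily (pathGraph G H h') W E F)
    {p q : HPath G H} (hpq : p ≠ q) : toEdge W F p * W q = 0 := by
  rw [← toEdge_mul_vert h p, mul_assoc, h.vert_mul_of_ne p q hpq, mul_zero]

theorem toEdge_mul_toEdge_of_ne (h : IsLeavittFamily (pathGraph G H h') W E F)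
    {p q : HPath G H} (hpq : p ≠ q) : toEdge W F p * toEdge W E q = 0 := by
  rw [← toEdge_mul_vert h p, mul_assoc, vert_mul_toEdge_of_ne h hpq, mul_zero]

theorem toEdge_mul_toEdge_mul_toEdge (h : IsLeavittFamily (pathGraph G H h') W E F)
    {p q : HPath G H} (hpq : rng q = rng p) :
    toEdge W E q * (toEdge W F p * toEdge W E p) = toEdge W E q := by
  rw [toEdge_mul_toEdge_self h, ← hpq, toEdge_mul_rng h]

theorem toEdge_mul_toEdge_mul_toEdge' (h : IsLeavittFamily (pathGraph G H h') W E F)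
    {p q : HPath G H} (hpq : rng q = rng p) :
    toEdge W F p * toEdge W E p * toEdge W F q = toEdge W F q := by
  rw [toEdge_mul_toEdge_self h, ← hpq, rng_mul_toEdge h]

variable {fib : G.V → Finset (HPath G H)}

/-- The image of a vertex of `G`: the sum of the paths issuing from it. -/
def sumVert (fib : G.V → Finset (HPath G H)) (W : HPath G H → B) (v : G.V) : B :=
  ∑ p ∈ fib v, W p

open Classical in
/-- The image of an edge `e` of `G`: the sum over `p` of `(e p) p*`, if `s e ∉ H`. -/
def sumEdge (fib : G.V → Finset (HPath G H)) (W : HPath G H → B)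
    (E F : {e : G.E // G.s e ∈ H} ⊕ FH G H → B) (e : G.E) : B :=
  if h : G.s e ∈ H then E (.inl ⟨e, h⟩)
  else ∑ p ∈ fib (G.r e), toEdge W E (cons e p) * toEdge W F p

open Classical in
/-- The image of a ghost edge of `G`: the sum over `p` of `p (e p)*`, if `s e ∉ H`. -/
def sumGhost (fib : G.V → Finset (HPath G H)) (W : HPath G H → B)
    (E F : {e : G.E // G.s e ∈ H} ⊕ FH G H → B) (e : G.E) : B :=
  if h : G.s e ∈ H then F (.inl ⟨e, h⟩)
  else ∑ p ∈ fib (G.r e), toEdge W E p * toEdge W F (cons e p)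

theorem sumVert_of_mem (h' : ∀ e : G.E, G.s e ∈ H → G.r e ∈ H)
    (hfib : ∀ v p, p ∈ fib v ↔ src p = v) (v : {v : G.V // v ∈ H}) :
    sumVert fib W v = W (Sum.inl v) := by
  have : fib v = {Sum.inl v} := by
    ext p
    rw [hfib, Finset.mem_singleton]
    exact src_eq_iff_of_mem h' v p
  rw [sumVert, this, Finset.sum_singleton]

theorem sumVert_mul_toEdge (h : IsLeavittFamily (pathGraph G H h') W E F)
    (hfib : ∀ v p, p ∈ fib v ↔ src p = v) (p : HPath G H) :
    sumVert fib W (src p) * toEdge W E p = toEdge W E p := by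
  rw [sumVert, Finset.sum_mul,
    Finset.sum_eq_single_of_mem p ((hfib _ _).2 rfl)
      fun q _ hq => vert_mul_toEdge_of_ne h hq, vert_mul_toEdge h]

theorem toEdge_mul_sumVert (h : IsLeavittFamily (pathGraph G H h') W E F)
    (hfib : ∀ v p, p ∈ fib v ↔ src p = v) (p : HPath G H) :
    toEdge W F p * sumVert fib W (src p) = toEdge W F p := by
  rw [sumVert, Finset.mul_sum,
    Finset.sum_eq_single_of_mem p ((hfib _ _).2 rfl)
      fun q _ hq => toEdge_mul_vert_of_ne h hq.symm, toEdge_mul_vert h]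

theorem sumEdge_mul_toEdge (h : IsLeavittFamily (pathGraph G H h') W E F)
    (hfib : ∀ v p, p ∈ fib v ↔ src p = v) {e : G.E} {p : HPath G H} (he : G.s e ∉ H)
    (hp : src p = G.r e) :
    sumEdge fib W E F e * toEdge W E p = toEdge W E (cons e p) := by
  rw [sumEdge, dif_neg he, Finset.sum_mul, Finset.sum_eq_single_of_mem p ((hfib _ _).2 hp),
    mul_assoc, toEdge_mul_toEdge_mul_toEdge h (rng_cons he hp)]
  intro q _ hq
  rw [mul_assoc, toEdge_mul_toEdge_of_ne h hq, mul_zero]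

theorem toEdge_mul_sumGhost (h : IsLeavittFamily (pathGraph G H h') W E F)
    (hfib : ∀ v p, p ∈ fib v ↔ src p = v) {e : G.E} {p : HPath G H} (he : G.s e ∉ H)
    (hp : src p = G.r e) :
    toEdge W F p * sumGhost fib W E F e = toEdge W F (cons e p) := by
  rw [sumGhost, dif_neg he, Finset.mul_sum, Finset.sum_eq_single_of_mem p ((hfib _ _).2 hp),
    ← mul_assoc, toEdge_mul_toEdge_mul_toEdge' h (rng_cons he hp)]
  intro q _ hq
  rw [← mul_assoc, toEdge_mul_toEdge_of_ne h hq.symm, zero_mul]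

theorem sumVert_mul_self (h : IsLeavittFamily (pathGraph G H h') W E F) (v : G.V) :
    sumVert fib W v * sumVert fib W v = sumVert fib W v := by
  simp only [sumVert]
  rw [Finset.sum_mul]
  refine Finset.sum_congr rfl fun p hp => ?_
  rw [Finset.mul_sum, Finset.sum_eq_single_of_mem p hp
    fun q _ hq => h.vert_mul_of_ne p q hq.symm, h.vert_mul_self]

theorem sumVert_mul_of_ne (h : IsLeavittFamily (pathGraph G H h') W E F)
    (hfib : ∀ v p, p ∈ fib v ↔ src p = v) {u v : G.V} (huv : u ≠ v) :
    sumVert fib W u * sumVert fib W v = 0 := by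
  simp only [sumVert]
  rw [Finset.sum_mul_sum]
  refine Finset.sum_eq_zero fun p hp => Finset.sum_eq_zero fun q hq => ?_
  refine h.vert_mul_of_ne p q ?_
  rintro rfl
  exact huv (((hfib _ _).1 hp).symm.trans ((hfib _ _).1 hq))

theorem sumVert_mul_sumEdge (h : IsLeavittFamily (pathGraph G H h') W E F)
    (hfib : ∀ v p, p ∈ fib v ↔ src p = v) (e : G.E) :
    sumVert fib W (G.s e) * sumEdge fib W E F e = sumEdge fib W E F e := by
  by_cases he : G.s e ∈ H
  · rw [sumEdge, dif_pos he, sumVert_of_mem h' hfib ⟨G.s e, he⟩]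
    exact h.source_mul (Sum.inl ⟨e, he⟩)
  · rw [sumEdge, dif_neg he, Finset.mul_sum]
    refine Finset.sum_congr rfl fun p hp => ?_
    rw [← mul_assoc, ← src_cons he ((hfib _ _).1 hp), sumVert_mul_toEdge h hfib]

theorem sumGhost_mul_sumVert (h : IsLeavittFamily (pathGraph G H h') W E F)
    (hfib : ∀ v p, p ∈ fib v ↔ src p = v) (e : G.E) :
    sumGhost fib W E F e * sumVert fib W (G.s e) = sumGhost fib W E F e := by
  by_cases he : G.s e ∈ H
  · rw [sumGhost, dif_pos he, sumVert_of_mem h' hfib ⟨G.s e, he⟩]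
    exact h.mul_source (Sum.inl ⟨e, he⟩)
  · rw [sumGhost, dif_neg he, Finset.sum_mul]
    refine Finset.sum_congr rfl fun p hp => ?_
    rw [mul_assoc, ← src_cons he ((hfib _ _).1 hp), toEdge_mul_sumVert h hfib]

theorem sumEdge_mul_sumVert (h : IsLeavittFamily (pathGraph G H h') W E F)
    (hfib : ∀ v p, p ∈ fib v ↔ src p = v) (e : G.E) :
    sumEdge fib W E F e * sumVert fib W (G.r e) = sumEdge fib W E F e := by
  by_cases he : G.s e ∈ H
  · rw [sumEdge, dif_pos he, sumVert_of_mem h' hfib ⟨G.r e, h' e he⟩]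
    exact h.mul_range (Sum.inl ⟨e, he⟩)
  · rw [sumEdge, dif_neg he, Finset.sum_mul]
    refine Finset.sum_congr rfl fun p hp => ?_
    rw [mul_assoc, ← (hfib _ _).1 hp, toEdge_mul_sumVert h hfib]

theorem sumVert_mul_sumGhost (h : IsLeavittFamily (pathGraph G H h') W E F)
    (hfib : ∀ v p, p ∈ fib v ↔ src p = v) (e : G.E) :
    sumVert fib W (G.r e) * sumGhost fib W E F e = sumGhost fib W E F e := by
  by_cases he : G.s e ∈ H
  · rw [sumGhost, dif_pos he, sumVert_of_mem h' hfib ⟨G.r e, h' e he⟩]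
    exact h.range_mul (Sum.inl ⟨e, he⟩)
  · rw [sumGhost, dif_neg he, Finset.mul_sum]
    refine Finset.sum_congr rfl fun p hp => ?_
    rw [← mul_assoc, ← (hfib _ _).1 hp, sumVert_mul_toEdge h hfib]

theorem sumGhost_mul_sumEdge_self (h : IsLeavittFamily (pathGraph G H h') W E F)
    (hfib : ∀ v p, p ∈ fib v ↔ src p = v) (e : G.E) :
    sumGhost fib W E F e * sumEdge fib W E F e = sumVert fib W (G.r e) := by
  by_cases he : G.s e ∈ H
  · rw [sumGhost, dif_pos he, sumEdge, dif_pos he, sumVert_of_mem h' hfib ⟨G.r e, h' e he⟩]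
    exact h.ghost_mul_self (Sum.inl ⟨e, he⟩)
  · rw [sumEdge, dif_neg he, Finset.mul_sum, sumVert]
    refine Finset.sum_congr rfl fun p hp => ?_
    have hp' := (hfib _ _).1 hp
    rw [sumGhost, dif_neg he, Finset.sum_mul, Finset.sum_eq_single_of_mem p hp]
    · rw [mul_assoc, ← mul_assoc (toEdge W F (cons e p)), toEdge_mul_toEdge_self h,
        rng_cons he hp', rng_mul_toEdge h, toEdge_mul_toEdge h]
    · intro q hq hqp
      have hq' := (hfib _ _).1 hq
      rw [mul_assoc, ← mul_assoc (toEdge W F (cons e q)), toEdge_mul_toEdge_of_ne h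
        fun hc => hqp (cons_injective he hq' he hp' hc).2, zero_mul, mul_zero]

theorem sumGhost_mul_sumEdge_of_ne (h : IsLeavittFamily (pathGraph G H h') W E F)
    (hfib : ∀ v p, p ∈ fib v ↔ src p = v) {e f : G.E} (hef : e ≠ f) :
    sumGhost fib W E F e * sumEdge fib W E F f = 0 := by
  by_cases hs : G.s e = G.s f
  · by_cases he : G.s e ∈ H
    · have hf : G.s f ∈ H := hs ▸ he
      rw [sumGhost, dif_pos he, sumEdge, dif_pos hf]
      refine h.ghost_mul_of_ne _ _ fun hc => hef ?_
      exact congrArg Subtype.val (Sum.inl_injective hc)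
    · have hf : G.s f ∉ H := hs ▸ he
      rw [sumGhost, dif_neg he, sumEdge, dif_neg hf, Finset.sum_mul_sum]
      refine Finset.sum_eq_zero fun p hp => Finset.sum_eq_zero fun q hq => ?_
      rw [mul_assoc, ← mul_assoc (toEdge W F (cons e p)), toEdge_mul_toEdge_of_ne h
        fun hc => hef (cons_injective he ((hfib _ _).1 hp) hf ((hfib _ _).1 hq) hc).1,
        zero_mul, mul_zero]
  · rw [← sumGhost_mul_sumVert h hfib, ← sumVert_mul_sumEdge h hfib, mul_assoc,
      ← mul_assoc (sumVert _ _ _) (sumVert _ _ _), sumVert_mul_of_ne h hfib hs, zero_mul, mul_zero]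

theorem sum_sumEdge_mul_sumGhost (h : IsLeavittFamily (pathGraph G H h') W E F)
    (hfib : ∀ v p, p ∈ fib v ↔ src p = v) (v : G.V) (S : Finset G.E)
    (hS : ∀ e, e ∈ S ↔ G.s e = v) (hne : S.Nonempty) :
    ∑ e ∈ S, sumEdge fib W E F e * sumGhost fib W E F e = sumVert fib W v := by
  by_cases hv : v ∈ H
  · have hmem : ∀ e ∈ S, G.s e ∈ H := fun e he => ((hS e).1 he).symm ▸ hv
    rw [sumVert_of_mem h' hfib ⟨v, hv⟩]
    let ι : {e // e ∈ S} ↪ {e : G.E // G.s e ∈ H} ⊕ FH G H :=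
      ⟨fun e => Sum.inl ⟨e.1, hmem e.1 e.2⟩, fun e f hef => by
        have := congrArg Subtype.val (Sum.inl_injective hef)
        exact Subtype.ext this⟩
    rw [← h.sum_edge_mul_ghost (Sum.inl ⟨v, hv⟩) (S.attach.map ι), Finset.sum_map,
      ← Finset.sum_attach]
    · refine Finset.sum_congr rfl fun e _ => ?_
      rw [sumEdge, dif_pos (hmem e.1 e.2), sumGhost, dif_pos (hmem e.1 e.2)]
      rfl
    · rintro (e | a)
      · refine Finset.mem_map.trans ⟨?_, fun he => ?_⟩
        · rintro ⟨f, -, hf⟩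
          rw [← hf]
          exact congrArg Sum.inl (Subtype.ext ((hS f.1).1 f.2))
        · have hev : G.s e.1 = v := congrArg Subtype.val (Sum.inl_injective he)
          exact ⟨⟨e.1, (hS e.1).2 hev⟩, Finset.mem_attach _ _, rfl⟩
      · refine Finset.mem_map.trans ⟨?_, fun ha => by cases ha⟩
        rintro ⟨f, -, hf⟩
        cases hf
    · simpa using hne
  · rw [sumVert, sum_eq_sum_cons h' hfib hv hS]
    refine Finset.sum_congr rfl fun e he => ?_
    have hes : G.s e ∉ H := ((hS e).1 he).symm ▸ hv
    rw [sumEdge, dif_neg hes, Finset.sum_mul]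
    refine Finset.sum_congr rfl fun p hp => ?_
    rw [mul_assoc, toEdge_mul_sumGhost h hfib hes ((hfib _ _).1 hp), toEdge_mul_toEdge h]

/-- A Leavitt family of `pathGraph G H` gives one of `G`. -/
theorem isLeavittFamily_sum (h : IsLeavittFamily (pathGraph G H h') W E F)
    (hfib : ∀ v p, p ∈ fib v ↔ src p = v) :
    IsLeavittFamily G (sumVert fib W) (sumEdge fib W E F) (sumGhost fib W E F) where
  vert_mul_self := sumVert_mul_self h
  vert_mul_of_ne _ _ := sumVert_mul_of_ne h hfib
  source_mul := sumVert_mul_sumEdge h hfib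
  mul_range := sumEdge_mul_sumVert h hfib
  range_mul := sumVert_mul_sumGhost h hfib
  mul_source := sumGhost_mul_sumVert h hfib
  ghost_mul_self := sumGhost_mul_sumEdge_self h hfib
  ghost_mul_of_ne _ _ := sumGhost_mul_sumEdge_of_ne h hfib
  sum_edge_mul_ghost := sum_sumEdge_mul_sumGhost h hfib

end PathGraphFamilies

theorem nonempty_LPA_algEquiv (R : Type) [CommRing R] (h' : ∀ e : G.E, G.s e ∈ H → G.r e ∈ H)
    (hind : ∀ P : G.V → Prop, (∀ v ∈ H, P v) →
      (∀ v, v ∉ H → (∀ e, G.s e = v → P (G.r e)) → P v) → ∀ v, P v)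
    (hreg : ∀ v, v ∉ H → IsRegular G v) :
    Nonempty (LPA R G ≃ₐ[R] LPA R (pathGraph G H h')) := by
  have hfin := finite_src_eq h' hind fun v hv => (hreg v hv).1
  let fib : G.V → Finset (HPath G H) := fun v => (hfin v).toFinset
  have hfib : ∀ v p, p ∈ fib v ↔ src p = v := fun v p => by simp [fib]
  have hA := isLeavittFamily_LPA R G
  have hB := isLeavittFamily_LPA R (pathGraph G H h')
  obtain ⟨f, fV, fE, fG⟩ := (isLeavittFamily_sum hB hfib).exists_lift (R := R)
  obtain ⟨g, gV, gE, gG⟩ := (isLeavittFamily_pathGraph h' hA).exists_lift (R := R)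
  have fx : ∀ p : HPath G H, f (pathEdge (Vq R G) (Eq' R G) p) =
      toEdge (Vq R (pathGraph G H h')) (Eq' R (pathGraph G H h')) p := by
    intro p
    induction p using cons_induction h' with
    | inl v => exact (fV v).trans (sumVert_of_mem h' hfib v)
    | cons e p he hp ih => rw [pathEdge_cons hA he hp, map_mul, ih, fE,
        sumEdge_mul_toEdge hB hfib he hp]
  have fy : ∀ p : HPath G H, f (pathGhost (Vq R G) (Gq R G) p) =
      toEdge (Vq R (pathGraph G H h')) (Gq R (pathGraph G H h')) p := by
    intro p
    induction p using cons_induction h' with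
    | inl v => exact (fV v).trans (sumVert_of_mem h' hfib v)
    | cons e p he hp ih => rw [pathGhost_cons hA he hp, map_mul, ih, fG,
        toEdge_mul_sumGhost hB hfib he hp]
  have gx : ∀ p : HPath G H, g (toEdge (Vq R (pathGraph G H h')) (Eq' R (pathGraph G H h')) p) =
      pathEdge (Vq R G) (Eq' R G) p := by
    rintro (v | a)
    · exact (gV (Sum.inl v)).trans (hA.vert_mul_self v)
    · exact gE (Sum.inr a)
  have gy : ∀ p : HPath G H, g (toEdge (Vq R (pathGraph G H h')) (Gq R (pathGraph G H h')) p) =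
      pathGhost (Vq R G) (Gq R G) p := by
    rintro (v | a)
    · exact (gV (Sum.inl v)).trans (hA.vert_mul_self v)
    · exact gG (Sum.inr a)
  have hsum := sum_pathEdge_mul_pathGhost h' hA hind hfib hreg
  refine ⟨AlgEquiv.ofAlgHom f g ?_ ?_⟩
  · refine LPA_hom_ext ?_ ?_ ?_
    · intro p
      rw [AlgHom.comp_apply, gV, map_mul, fx, fy, toEdge_mul_toEdge hB, AlgHom.id_apply]
    · rintro (e | a)
      · rw [AlgHom.comp_apply, gE, AlgHom.id_apply, Sum.elim_inl, fE, sumEdge, dif_pos e.2]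
      · rw [AlgHom.comp_apply, gE, AlgHom.id_apply, Sum.elim_inr, fx, toEdge]
    · rintro (e | a)
      · rw [AlgHom.comp_apply, gG, AlgHom.id_apply, Sum.elim_inl, fG, sumGhost, dif_pos e.2]
      · rw [AlgHom.comp_apply, gG, AlgHom.id_apply, Sum.elim_inr, fy, toEdge]
  · refine LPA_hom_ext ?_ ?_ ?_
    · intro v
      rw [AlgHom.comp_apply, fV, AlgHom.id_apply, sumVert, map_sum, ← hsum v]
      exact Finset.sum_congr rfl fun p _ => gV p
    · intro e
      rw [AlgHom.comp_apply, fE, AlgHom.id_apply, sumEdge]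
      split_ifs with he
      · exact gE (Sum.inl ⟨e, he⟩)
      · rw [map_sum]
        refine Eq.trans ?_ (hA.mul_range e)
        rw [← hsum (G.r e), Finset.mul_sum]
        refine Finset.sum_congr rfl fun p hp => ?_
        rw [map_mul, gx, gy, pathEdge_cons hA he ((hfib _ _).1 hp), mul_assoc]
    · intro e
      rw [AlgHom.comp_apply, fG, AlgHom.id_apply, sumGhost]
      split_ifs with he
      · exact gG (Sum.inl ⟨e, he⟩)
      · rw [map_sum]
        refine Eq.trans ?_ (hA.range_mul e)
        rw [← hsum (G.r e), Finset.sum_mul]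
        refine Finset.sum_congr rfl fun p hp => ?_
        rw [map_mul, gx, gy, pathGhost_cons hA he ((hfib _ _).1 hp), mul_assoc]

end HPath

theorem stmt0 (R : Type) [CommRing R] (G : DGraph) (H : Set G.V) (hH : Hereditary G H)
    (hfinV : Finite {v : G.V // v ∉ H}) (hfinE : Finite {e : G.E // G.r e ∉ H})
    (hacyc : ∀ (l : List G.E) (hl : l ≠ []), List.Chain' (fun e f => G.r e = G.s f) l →
      (∀ e ∈ l, G.r e ∉ H) → G.r (l.getLast hl) ≠ G.s (l.head hl))
    (hpath : ∀ v : G.V, v ∉ H → ∃ w ∈ H, Reaches G v w)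
    (hcross : Finite {e : G.E // G.s e ∉ H ∧ G.r e ∈ H}) :
    Nonempty (LPA R G ≃ₐ[R] LPA R (graphEH G H (fun e he =>
      hH _ he _ (Relation.ReflTransGen.single ⟨e, rfl, rfl⟩)))) := by
  have h' : ∀ e : G.E, G.s e ∈ H → G.r e ∈ H :=
    fun e he => hH _ he _ (Relation.ReflTransGen.single ⟨e, rfl, rfl⟩)
  have hreg : ∀ v, v ∉ H → IsRegular G v := by
    intro v hv
    refine ⟨?_, ?_⟩
    · have h₁ : {e : G.E | G.r e ∉ H}.Finite := hfinE
      have h₂ : {e : G.E | G.s e ∉ H ∧ G.r e ∈ H}.Finite := hcross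
      refine (h₁.union h₂).subset fun e he => ?_
      by_cases hr : G.r e ∈ H
      · exact Or.inr ⟨fun hs => hv (he ▸ hs), hr⟩
      · exact Or.inl hr
    · obtain ⟨w, hw, hvw⟩ := hpath v hv
      rcases Relation.ReflTransGen.cases_head hvw with rfl | ⟨u, ⟨e, he, -⟩, -⟩
      · exact absurd hw hv
      · exact ⟨e, he⟩
  exact HPath.nonempty_LPA_algEquiv R h'
    (fun _ mem step v => HPath.vertex_induction hfinV hacyc mem step v) hreg
end
end

section
/- Let R be a commutative unital ring and E a finite directed graph with no sinks. Then there exists a finite directed graph G with no sinks and no sources such that the Leavitt path algebras L_R(E) and L_R(G) are isomorphic as R-algebras. -/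
noncomputable section

open DGraph

namespace DGraph

open Classical in
/-- A Leavitt family for a finite graph without sinks: the defining relations of the Leavitt path
algebra, with the sum over the edges emitted by a vertex written as a sum over all edges. -/
structure IsFamily (G : DGraph) [Fintype G.E] {A : Type} [Ring A]
    (p : G.V → A) (a b : G.E → A) : Prop where
  vmul : ∀ u v, p u * p v = if u = v then p u else 0
  se : ∀ e, p (G.s e) * a e = a e
  er : ∀ e, a e * p (G.r e) = a e
  rg : ∀ e, p (G.r e) * b e = b e
  gs : ∀ e, b e * p (G.s e) = b e
  ck1 : ∀ e f, b e * a f = if e = f then p (G.r e) else 0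
  ck2 : ∀ v, ∑ e, (if G.s e = v then a e * b e else 0) = p v

namespace IsFamily

variable {G : DGraph} [Fintype G.E] {A : Type} [Ring A] {p : G.V → A} {a b : G.E → A}

open Classical in
theorem vert_mul_edge (F : IsFamily G p a b) (v : G.V) (e : G.E) :
    p v * a e = if v = G.s e then a e else 0 := by
  rw [← F.se e, ← mul_assoc, F.vmul]
  split_ifs with h
  · rw [h]
  · simp

open Classical in
theorem edge_mul_vert (F : IsFamily G p a b) (e : G.E) (v : G.V) :
    a e * p v = if v = G.r e then a e else 0 := by
  rw [← F.er e, mul_assoc, F.vmul]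
  split_ifs with h h' h'
  · rw [F.er]
  · exact absurd h.symm h'
  · exact absurd h'.symm h
  · simp

open Classical in
theorem ghost_mul_vert (F : IsFamily G p a b) (e : G.E) (v : G.V) :
    b e * p v = if v = G.s e then b e else 0 := by
  rw [← F.gs e, mul_assoc, F.vmul]
  split_ifs with h h' h'
  · rw [F.gs]
  · exact absurd h.symm h'
  · exact absurd h'.symm h
  · simp

open Classical in
theorem vert_mul_ghost (F : IsFamily G p a b) (v : G.V) (e : G.E) :
    p v * b e = if v = G.r e then b e else 0 := by
  rw [← F.rg e, ← mul_assoc, F.vmul]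
  split_ifs with h
  · rw [h]
  · simp

/-- The homomorphism out of the Leavitt path algebra given by a Leavitt family. -/
def lift (R : Type) [CommRing R] [Algebra R A] (F : IsFamily G p a b) : LPA R G →ₐ[R] A :=
  RingQuot.liftAlgHom R ⟨FreeAlgebra.lift R (fun x => match x with
    | Gen.vert v => p v
    | Gen.edge e => a e
    | Gen.ghost e => b e), by
    intro x y h
    induction h with
    | vmul u v =>
      simp only [gv, map_mul, FreeAlgebra.lift_ι_apply, F.vmul]
      split_ifs <;> simp
    | se e => simp [gv, ge, F.se]
    | er e => simp [gv, ge, F.er]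
    | rg e => simp [gv, gg, F.rg]
    | gs e => simp [gv, gg, F.gs]
    | ck1 e f =>
      simp only [gv, ge, gg, map_mul, FreeAlgebra.lift_ι_apply, F.ck1]
      split_ifs <;> simp
    | ck2 v h =>
      classical
      simp only [gv, ge, gg, map_sum, map_mul, FreeAlgebra.lift_ι_apply]
      rw [← F.ck2 v, ← Finset.sum_filter]
      refine Finset.sum_congr ?_ fun _ _ => rfl
      ext e
      simp⟩

variable (R : Type) [CommRing R] [Algebra R A] (F : IsFamily G p a b)

@[simp] theorem lift_vert (v : G.V) : F.lift R (Vq R G v) = p v := by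
  simp [lift, Vq, gv]

@[simp] theorem lift_edge (e : G.E) : F.lift R (Eq' R G e) = a e := by
  simp [lift, Eq', ge]

@[simp] theorem lift_ghost (e : G.E) : F.lift R (Gq R G e) = b e := by
  simp [lift, Gq, gg]

end IsFamily

theorem isFamily_generators (R : Type) [CommRing R] (G : DGraph) [Fintype G.E]
    (hns : NoSinks G) : IsFamily G (Vq R G) (Eq' R G) (Gq R G) where
  vmul u v := by
    simpa [Vq, apply_ite] using RingQuot.mkAlgHom_rel R (LRel.vmul (R := R) u v)
  se e := by simpa [Vq, Eq'] using RingQuot.mkAlgHom_rel R (LRel.se (R := R) e)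
  er e := by simpa [Vq, Eq'] using RingQuot.mkAlgHom_rel R (LRel.er (R := R) e)
  rg e := by simpa [Vq, Gq] using RingQuot.mkAlgHom_rel R (LRel.rg (R := R) e)
  gs e := by simpa [Vq, Gq] using RingQuot.mkAlgHom_rel R (LRel.gs (R := R) e)
  ck1 e f := by
    simpa [Vq, Eq', Gq, apply_ite] using RingQuot.mkAlgHom_rel R (LRel.ck1 (R := R) e f)
  ck2 v := by
    classical
    have h := RingQuot.mkAlgHom_rel R (LRel.ck2 (R := R) v ⟨Set.toFinite _, hns v⟩)
    simp only [map_sum, map_mul] at h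
    rw [Vq, ← h, ← Finset.sum_filter]
    refine Finset.sum_congr ?_ fun _ _ => rfl
    ext e
    simp

theorem algHom_ext {R : Type} [CommRing R] {G : DGraph} {A : Type} [Ring A] [Algebra R A]
    {φ ψ : LPA R G →ₐ[R] A} (hv : ∀ v, φ (Vq R G v) = ψ (Vq R G v))
    (he : ∀ e, φ (Eq' R G e) = ψ (Eq' R G e)) (hg : ∀ e, φ (Gq R G e) = ψ (Gq R G e)) :
    φ = ψ := by
  refine RingQuot.ringQuot_ext' _ _ _ (FreeAlgebra.hom_ext (funext fun x => ?_))
  cases x with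
  | vert v => exact hv v
  | edge e => exact he e
  | ghost e => exact hg e

/-- A graph obtained from `G` by letting the edge `f` end in `v`. -/
abbrev redirect (G : DGraph) (f : G.E) (v : G.V) : DGraph where
  V := G.V
  E := G.E
  s := G.s
  r := by classical exact Function.update G.r f v

section Redirect

variable {G : DGraph} {e₀ f : G.E} {A : Type} [Ring A]
  {p : G.V → A} {a b : G.E → A}

theorem redirect_r_self : (G.redirect f (G.s e₀)).r f = G.s e₀ := by
  simp [redirect]

theorem redirect_r_of_ne {e : G.E} (h : e ≠ f) : (G.redirect f (G.s e₀)).r e = G.r e := by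
  simp [redirect, h]

variable [Fintype G.E]

theorem IsFamily.edge_mul_ghost_of_unique (F : IsFamily G p a b)
    (huniq : ∀ e, G.s e = G.s e₀ → e = e₀) : a e₀ * b e₀ = p (G.s e₀) := by
  classical
  rw [← F.ck2, Finset.sum_eq_single e₀]
  · simp
  · intro e _ he
    rw [if_neg fun h => he (huniq e h)]
  · simp

open Classical in
theorem IsFamily.redirect (F : IsFamily G p a b) (huniq : ∀ e, G.s e = G.s e₀ → e = e₀)
    (hr : G.r f = G.r e₀) :
    IsFamily (G.redirect f (G.s e₀)) p (fun e : G.E => if e = f then a f * b e₀ else a e)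
      (fun e : G.E => if e = f then a e₀ * b f else b e) where
  vmul := F.vmul
  se (e : G.E) := by
    change p (G.s e) * _ = _
    split_ifs with h
    · rw [← mul_assoc, h, F.se]
    · exact F.se e
  er (e : G.E) := by
    by_cases h : e = f
    · subst h
      rw [if_pos rfl, redirect_r_self, mul_assoc, F.gs]
    · rw [if_neg h, redirect_r_of_ne h, F.er]
  rg (e : G.E) := by
    by_cases h : e = f
    · subst h
      rw [if_pos rfl, redirect_r_self, ← mul_assoc, F.se]
    · rw [if_neg h, redirect_r_of_ne h, F.rg]
  gs (e : G.E) := by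
    change _ * p (G.s e) = _
    split_ifs with h
    · rw [mul_assoc, h, F.gs]
    · exact F.gs e
  ck1 (e e' : G.E) := by
    by_cases h : e = f <;> by_cases h' : e' = f
    · subst h; subst h'
      rw [if_pos rfl, if_pos rfl, if_pos rfl, redirect_r_self, mul_assoc, ← mul_assoc (b _),
        F.ck1, if_pos rfl, hr, F.rg, F.edge_mul_ghost_of_unique huniq]
    · rw [if_pos h, if_neg h', if_neg (by grind), mul_assoc, F.ck1, if_neg (by grind), mul_zero]
    · rw [if_neg h, if_pos h', if_neg (by grind), ← mul_assoc, F.ck1, if_neg (by grind), zero_mul]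
    · rw [if_neg h, if_neg h', redirect_r_of_ne h, F.ck1]
  ck2 (v : G.V) := by
    rw [← F.ck2 v]
    refine Finset.sum_congr rfl fun (e : G.E) _ => ?_
    change (if G.s e = v then _ else _) = _
    by_cases h : e = f
    · subst h
      simp only [if_true]
      rw [mul_assoc, ← mul_assoc (b _), F.ck1, if_pos rfl, ← hr, F.rg]
    · simp only [if_neg h]

open Classical in
theorem IsFamily.of_redirect
    (F : IsFamily (G.redirect f (G.s e₀)) p a b) (huniq : ∀ e, G.s e = G.s e₀ → e = e₀)
    (hf : f ≠ e₀) (hr : G.r f = G.r e₀) :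
    IsFamily G p (fun e : G.E => if e = f then a f * a e₀ else a e)
      (fun e : G.E => if e = f then b e₀ * b f else b e) := by
  have hs : (G.redirect f (G.s e₀)).r f = (G.redirect f (G.s e₀)).s e₀ := redirect_r_self
  have hre : ∀ e : G.E, e ≠ f → (G.redirect f (G.s e₀)).r e = G.r e := fun e => redirect_r_of_ne
  have hab : a e₀ * b e₀ = p (G.s e₀) :=
    F.edge_mul_ghost_of_unique (G := G.redirect f (G.s e₀)) (e₀ := e₀) huniq
  refine ⟨F.vmul, fun e => ?_, fun e => ?_, fun e => ?_, fun e => ?_, fun e e' => ?_, fun v => ?_⟩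
  · split_ifs with h
    · rw [← mul_assoc, h]
      exact congrArg (· * _) (F.se f)
    · exact F.se e
  · by_cases h : e = f
    · rw [if_pos h, h, hr, ← hre e₀ hf.symm, mul_assoc, F.er]
    · rw [if_neg h, ← hre e h, F.er]
  · by_cases h : e = f
    · rw [if_pos h, h, hr, ← hre e₀ hf.symm, ← mul_assoc, F.rg]
    · rw [if_neg h, ← hre e h, F.rg]
  · split_ifs with h
    · rw [mul_assoc, h]
      exact congrArg (_ * ·) (F.gs f)
    · exact F.gs e
  · by_cases h : e = f <;> by_cases h' : e' = f
    · rw [if_pos h, if_pos h', if_pos (h.trans h'.symm), mul_assoc, ← mul_assoc (b f),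
        F.ck1, if_pos rfl, hs, F.se, F.ck1, if_pos rfl, h, hr, hre e₀ hf.symm]
    · rw [if_pos h, if_neg h', if_neg (by grind), mul_assoc, F.ck1, if_neg (Ne.symm h'), mul_zero]
    · rw [if_neg h, if_pos h', if_neg (by grind), ← mul_assoc, F.ck1, if_neg h, zero_mul]
    · rw [if_neg h, if_neg h', ← hre e h]
      exact F.ck1 e e'
  · rw [← F.ck2 v]
    refine Finset.sum_congr rfl fun (e : G.E) _ => ?_
    change _ = (if G.s e = v then _ else _)
    by_cases h : e = f
    · subst h
      simp only [if_true]
      have hrg : p (G.s e₀) * b e = b e := 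
        (F.vert_mul_ghost _ e).trans (if_pos hs.symm)
      rw [mul_assoc, ← mul_assoc (a e₀), hab, hrg]
    · simp only [if_neg h]

end Redirect

theorem redirect_equiv (R : Type) [CommRing R] {G : DGraph} [Finite G.E] (hns : NoSinks G)
    {e₀ f : G.E} (huniq : ∀ e, G.s e = G.s e₀ → e = e₀) (hf : f ≠ e₀) (hr : G.r f = G.r e₀) :
    Nonempty (LPA R G ≃ₐ[R] LPA R (G.redirect f (G.s e₀))) := by
  classical
  have := Fintype.ofFinite G.E
  have hns' : NoSinks (G.redirect f (G.s e₀)) := hns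
  have F := isFamily_generators R G hns
  have F' := isFamily_generators R _ hns'
  have hab := F'.edge_mul_ghost_of_unique (G := G.redirect f (G.s e₀)) (e₀ := e₀) huniq
  have hs : (G.redirect f (G.s e₀)).r f = (G.redirect f (G.s e₀)).s e₀ := redirect_r_self
  refine ⟨AlgEquiv.ofAlgHom ((F'.of_redirect huniq hf hr).lift R)
    ((F.redirect huniq hr).lift R) (algHom_ext ?_ ?_ ?_) (algHom_ext ?_ ?_ ?_)⟩
  · intro v
    simp
  · intro (e : G.E)
    by_cases h : e = f
    · subst h
      simp only [AlgHom.comp_apply, IsFamily.lift_edge, IsFamily.lift_ghost, AlgHom.id_apply,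
        if_true, map_mul, if_neg hf.symm]
      rw [mul_assoc, hab, F'.edge_mul_vert, if_pos hs.symm]
    · simp [h]
  · intro (e : G.E)
    by_cases h : e = f
    · subst h
      simp only [AlgHom.comp_apply, IsFamily.lift_edge, IsFamily.lift_ghost, AlgHom.id_apply,
        if_true, map_mul, if_neg hf.symm]
      rw [← mul_assoc, hab, F'.vert_mul_ghost, if_pos hs.symm]
    · simp [h]
  · intro v
    simp
  · intro e
    by_cases h : e = f
    · subst h
      simp only [AlgHom.comp_apply, IsFamily.lift_edge, AlgHom.id_apply,
        if_true, map_mul, if_neg hf.symm]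
      rw [mul_assoc, F.ck1, if_pos rfl, ← hr, F.er]
    · simp [h]
  · intro e
    by_cases h : e = f
    · subst h
      simp only [AlgHom.comp_apply, IsFamily.lift_ghost, AlgHom.id_apply,
        if_true, map_mul, if_neg hf.symm]
      rw [← mul_assoc, F.ck1, if_pos rfl, ← hr, F.rg]
    · simp [h]

/-- The graph obtained from `G` by splitting the vertex `v`, which supports no loop, into one source
for each edge `e` emitted by `v`; the edges `f` into `v` are replaced by the paths `f e`. -/
abbrev split (G : DGraph) (v : G.V) (hl : ∀ e, G.s e = v → G.r e ≠ v) : DGraph where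
  V := {x : G.V // x ≠ v} ⊕ {e : G.E // G.s e = v}
  E := {f : G.E // G.r f ≠ v} ⊕ ({f : G.E // G.r f = v} × {e : G.E // G.s e = v})
  s := by
    classical
    exact Sum.elim (fun f => if h : G.s f = v then .inr ⟨f, h⟩ else .inl ⟨G.s f, h⟩)
      (fun q => .inl ⟨G.s q.1, fun h => hl _ h q.1.2⟩)
  r := Sum.elim (fun f => .inl ⟨G.r f, f.2⟩) (fun q => .inl ⟨G.r q.2, hl _ q.2.2⟩)

section Split

variable {G : DGraph} {v : G.V} {hl : ∀ e, G.s e = v → G.r e ≠ v}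

theorem split_s_inl_eq_inl {f : {f : G.E // G.r f ≠ v}} {x : {x : G.V // x ≠ v}} :
    (G.split v hl).s (.inl f) = .inl x ↔ G.s f = x := by
  by_cases h : G.s f = v
  · simp [h, x.2.symm]
  · simp [h, Subtype.ext_iff]

theorem split_s_inl_eq_inr {f : {f : G.E // G.r f ≠ v}} {e : {e : G.E // G.s e = v}} :
    (G.split v hl).s (.inl f) = .inr e ↔ f.1 = e := by
  by_cases h : G.s f = v
  · simp [h, Subtype.ext_iff]
  · simp only [Sum.elim_inl, h, dite_false, reduceCtorEq, false_iff]
    exact fun h' => h (h' ▸ e.2)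

variable [Fintype G.E] {A : Type} [Ring A]

open Classical in
theorem IsFamily.ck1_assoc {p : G.V → A} {a b : G.E → A} (F : IsFamily G p a b) (e f : G.E)
    (x : A) : b e * (a f * x) = if e = f then p (G.r e) * x else 0 := by
  rw [← mul_assoc, F.ck1]
  split_ifs <;> simp

open Classical in
theorem IsFamily.sum_subtype {p : G.V → A} {a b : G.E → A} (F : IsFamily G p a b) (v : G.V) :
    ∑ e : {e : G.E // G.s e = v}, a e * b e = p v := by
  rw [← F.ck2 v, ← Finset.sum_filter]
  exact (Finset.sum_subtype _ (by simp) fun e => a e * b e).symm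

open Classical in
theorem IsFamily.split {p : G.V → A} {a b : G.E → A} (F : IsFamily G p a b)
    (hl : ∀ e, G.s e = v → G.r e ≠ v) :
    IsFamily (G.split v hl) (Sum.elim (fun x => p x) (fun e => a e * b e))
      (Sum.elim (fun f => a f) (fun q => a q.1 * a q.2))
      (Sum.elim (fun f => b f) (fun q => b q.2 * b q.1)) where
  vmul := by
    rintro (x | e) (y | f)
    · simp [F.vmul, Subtype.ext_iff]
    · simp [← mul_assoc, F.vert_mul_edge, f.2, x.2]
    · simp [mul_assoc, F.ghost_mul_vert, e.2, y.2]
    · simp only [Sum.elim_inr, Sum.inr.injEq, Subtype.ext_iff, mul_assoc, F.ck1_assoc]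
      split_ifs with h
      · rw [h, F.rg]
      · simp
  se := by
    rintro (f | ⟨f, e⟩)
    · by_cases h : G.s f = v
      · simp [h, mul_assoc, F.ck1, F.er]
      · simp [h, F.se]
    · simp [← mul_assoc, F.se]
  er := by
    rintro (f | ⟨f, e⟩)
    · simp [F.er]
    · simp [mul_assoc, F.er]
  rg := by
    rintro (f | ⟨f, e⟩)
    · simp [F.rg]
    · simp [← mul_assoc, F.rg]
  gs := by
    rintro (f | ⟨f, e⟩)
    · by_cases h : G.s f = v
      · simp [h, F.ck1_assoc, F.rg]
      · simp [h, F.gs]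
    · simp [mul_assoc, F.gs]
  ck1 := by
    rintro (f | ⟨f, e⟩) (f' | ⟨f', e'⟩)
    · simp [F.ck1, Subtype.ext_iff]
    · have : f.1 ≠ f'.1 := fun h => f.2 (h ▸ f'.2)
      simp [F.ck1_assoc, this]
    · have : f.1 ≠ f'.1 := fun h => f'.2 (h ▸ f.2)
      simp [mul_assoc, F.ck1, this]
    · have hp : p (G.r f) * a e' = a e' :=
        (F.vert_mul_edge _ _).trans (if_pos (f.2.trans e'.2.symm))
      simp only [Sum.elim_inr, mul_assoc, F.ck1_assoc, Sum.inr.injEq, Prod.mk.injEq,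
        Subtype.ext_iff]
      by_cases h : f.1 = f'.1
      · obtain rfl : f = f' := Subtype.ext h
        simp [hp, F.ck1]
      · simp [h]
  ck2 := by
    rintro (x | e)
    · rw [Fintype.sum_sum_type, Fintype.sum_prod_type]
      refine Eq.trans ?_
        ((Fintype.sum_subtype_add_sum_subtype (fun f => G.r f ≠ v) _).trans (F.ck2 x))
      refine congrArg₂ (· + ·) (Finset.sum_congr rfl fun f _ => ?_) ?_
      · by_cases h : G.s f = x
        · rw [if_pos h, if_pos (split_s_inl_eq_inl.2 h)]
          rfl
        · rw [if_neg h, if_neg (mt split_s_inl_eq_inl.1 h)]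
      simp only [Sum.elim_inr, Sum.inl.injEq, Subtype.ext_iff]
      rw [← (Equiv.subtypeEquivRight (p := fun f => ¬ G.r f ≠ v) (q := fun f => G.r f = v)
        fun f => not_not).sum_comp]
      refine Finset.sum_congr rfl fun f _ => ?_
      have hf : G.r f = v := not_not.1 f.2
      have : a f * p v * b f = a f * b f := by
        rw [F.edge_mul_vert, if_pos hf.symm]
      rw [← this, ← F.sum_subtype v, Finset.mul_sum, Finset.sum_mul]
      simp only [Equiv.subtypeEquivRight_apply_coe, mul_assoc]
      split_ifs <;> simp
    · rw [Fintype.sum_sum_type, Finset.sum_eq_single ⟨e.1, hl e e.2⟩]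
      · simp [e.2]
      · intro f _ hf
        rw [if_neg]
        rw [split_s_inl_eq_inr]
        exact fun h => hf (Subtype.ext h)
      · simp

section Unsplit

variable {P : (G.split v hl).V → A} {a b : (G.split v hl).E → A}

open Classical in
/-- The vertex elements of the family for `G` recovered from a family for `G.split v hl`. -/
def unsplitVert (P : (G.split v hl).V → A) (x : G.V) : A :=
  if h : x = v then ∑ e : {e : G.E // G.s e = v}, P (.inr e) else P (.inl ⟨x, h⟩)

open Classical in
/-- The edge elements of the family for `G` recovered from a family for `G.split v hl`. -/
def unsplitEdge (a b : (G.split v hl).E → A) (f : G.E) : A :=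
  if h : G.r f = v then
    ∑ e : {e : G.E // G.s e = v}, a (.inr (⟨f, h⟩, e)) * b (.inl ⟨e, hl e e.2⟩)
  else a (.inl ⟨f, h⟩)

open Classical in
/-- The ghost elements of the family for `G` recovered from a family for `G.split v hl`. -/
def unsplitGhost (a b : (G.split v hl).E → A) (f : G.E) : A :=
  if h : G.r f = v then
    ∑ e : {e : G.E // G.s e = v}, a (.inl ⟨e, hl e e.2⟩) * b (.inr (⟨f, h⟩, e))
  else b (.inl ⟨f, h⟩)

open Classical in
theorem IsFamily.edge_mul_ghost_split (F : IsFamily (G.split v hl) P a b)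
    (e : {e : G.E // G.s e = v}) :
    a (.inl ⟨e, hl e e.2⟩) * b (.inl ⟨e, hl e e.2⟩) = P (.inr e) := by
  have hs : (G.split v hl).s (.inl ⟨e, hl e e.2⟩) = .inr e := split_s_inl_eq_inr.2 rfl
  rw [← hs]
  refine F.edge_mul_ghost_of_unique (G := G.split v hl) ?_
  rw [hs]
  rintro (f | q) h
  · exact congrArg Sum.inl (Subtype.ext (split_s_inl_eq_inr.1 h))
  · simp at h

open Classical in
theorem IsFamily.unsplit (F : IsFamily (G.split v hl) P a b) :
    IsFamily G (unsplitVert P) (unsplitEdge a b) (unsplitGhost a b) := by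
  have hsv (e : {e : G.E // G.s e = v}) : (G.split v hl).s (.inl ⟨e, hl e e.2⟩) = .inr e :=
    split_s_inl_eq_inr.2 rfl
  have hsn (f : G.E) (h : G.r f ≠ v) (h' : G.s f ≠ v) :
    (G.split v hl).s (.inl ⟨f, h⟩) = .inl ⟨G.s f, h'⟩ := split_s_inl_eq_inl.2 rfl
  have hK := F.edge_mul_ghost_split
  have hGS (f : {f : G.E // G.s f = v}) (e : {e : G.E // G.s e = v}) :
      b (.inl ⟨f, hl f f.2⟩) * P (.inr e) = if f = e then b (.inl ⟨f, hl f f.2⟩) else 0 := by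
    rw [F.ghost_mul_vert, hsv]
    simp [eq_comm]
  have hSE (f : {f : G.E // G.s f = v}) (e : {e : G.E // G.s e = v}) :
      P (.inr e) * a (.inl ⟨f, hl f f.2⟩) = if e = f then a (.inl ⟨f, hl f f.2⟩) else 0 := by
    rw [F.vert_mul_edge, hsv]
    simp
  refine ⟨fun x y => ?_, fun f => ?_, fun f => ?_, fun f => ?_, fun f => ?_, fun f f' => ?_,
    fun x => ?_⟩
  · by_cases hx : x = v <;> by_cases hy : y = v
    · simp [unsplitVert, hx, hy, Finset.sum_mul_sum, F.vmul]
    · have : v ≠ y := Ne.symm hy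
      simp [unsplitVert, hx, hy, this, Finset.sum_mul, F.vmul]
    · simp [unsplitVert, hx, hy, Finset.mul_sum, F.vmul]
    · simp [unsplitVert, hx, hy, F.vmul]
  · by_cases hs : G.s f = v
    · have hr := hl f hs
      simp only [unsplitVert, unsplitEdge, hs, hr, dite_true, dite_false, Finset.sum_mul]
      simp [hSE ⟨f, hs⟩]
    · by_cases hr : G.r f = v
      · simp only [unsplitVert, unsplitEdge, hs, hr, dite_true, dite_false, Finset.mul_sum,
          ← mul_assoc]
        exact Finset.sum_congr rfl fun e _ => congrArg (· * _) (F.se (.inr (⟨f, hr⟩, e)))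
      · simp only [unsplitVert, unsplitEdge, hs, hr, dite_false]
        rw [F.vert_mul_edge, hsn f hr hs, if_pos rfl]
  · by_cases hr : G.r f = v
    · simp only [unsplitVert, unsplitEdge, hr, dite_true, Finset.sum_mul_sum, mul_assoc, hGS]
      simp
    · simp only [unsplitVert, unsplitEdge, hr, dite_false]
      exact F.er (.inl ⟨f, hr⟩)
  · by_cases hr : G.r f = v
    · simp only [unsplitVert, unsplitGhost, hr, dite_true, Finset.sum_mul_sum, ← mul_assoc, hSE]
      simp
    · simp only [unsplitVert, unsplitGhost, hr, dite_false]
      exact F.rg (.inl ⟨f, hr⟩)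
  · by_cases hs : G.s f = v
    · have hr := hl f hs
      simp only [unsplitVert, unsplitGhost, hs, hr, dite_true, dite_false, Finset.mul_sum]
      simp [hGS ⟨f, hs⟩]
    · by_cases hr : G.r f = v
      · simp only [unsplitVert, unsplitGhost, hs, hr, dite_true, dite_false, Finset.sum_mul,
          mul_assoc]
        exact Finset.sum_congr rfl fun e _ => congrArg (_ * ·) (F.gs (.inr (⟨f, hr⟩, e)))
      · simp only [unsplitVert, unsplitGhost, hs, hr, dite_false]
        rw [F.ghost_mul_vert, hsn f hr hs, if_pos rfl]
  · by_cases hr : G.r f = v <;> by_cases hr' : G.r f' = v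
    · have hrg (e : {e : G.E // G.s e = v}) :
          P (.inl ⟨G.r e, hl e e.2⟩) * b (.inl ⟨e, hl e e.2⟩)
            = b (.inl ⟨e, hl e e.2⟩) := F.rg (.inl ⟨e, hl e e.2⟩)
      simp only [unsplitVert, unsplitEdge, unsplitGhost, hr, hr', dite_true, Finset.sum_mul_sum,
        mul_assoc, F.ck1_assoc]
      by_cases h : f = f'
      · subst h
        simp [hrg, hK]
      · simp [h]
    · have h : f ≠ f' := fun h => hr' (h ▸ hr)
      simp [unsplitEdge, unsplitGhost, hr, hr', h, Finset.sum_mul, mul_assoc, F.ck1]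
    · have h : f ≠ f' := fun h => hr (h ▸ hr')
      simp [unsplitEdge, unsplitGhost, hr, hr', h, Finset.mul_sum, F.ck1_assoc]
    · simp [unsplitVert, unsplitEdge, unsplitGhost, hr, hr', F.ck1]
  · have hprod (f : G.E) (h : G.r f = v) : unsplitEdge a b f * unsplitGhost a b f
        = ∑ e : {e : G.E // G.s e = v}, a (.inr (⟨f, h⟩, e)) * b (.inr (⟨f, h⟩, e)) := by
      have hrg (e : {e : G.E // G.s e = v}) :
          P (.inl ⟨G.r e, hl e e.2⟩) * b (.inr (⟨f, h⟩, e)) = b (.inr (⟨f, h⟩, e)) :=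
        F.rg (.inr (⟨f, h⟩, e))
      simp only [unsplitEdge, unsplitGhost, h, dite_true, Finset.sum_mul_sum, mul_assoc,
        F.ck1_assoc]
      simp [Subtype.val_inj, hrg]
    by_cases hx : x = v
    · rw [← Finset.sum_filter, Finset.sum_subtype (p := fun e => G.s e = v) _ (by simp [hx])]
      simp only [unsplitVert, hx, dite_true]
      refine Finset.sum_congr rfl fun e _ => ?_
      have hr := hl e e.2
      simp only [unsplitEdge, unsplitGhost, hr, dite_false]
      exact hK e
    · rw [← Fintype.sum_subtype_add_sum_subtype (fun f => G.r f ≠ v)]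
      simp only [unsplitVert, hx, dite_false]
      rw [← F.ck2, Fintype.sum_sum_type, Fintype.sum_prod_type]
      refine congrArg₂ (· + ·) (Finset.sum_congr rfl fun f _ => ?_) ?_
      · by_cases h : G.s f = x
        · rw [if_pos h, if_pos (split_s_inl_eq_inl.2 h)]
          simp only [unsplitEdge, unsplitGhost, f.2, dite_false]
        · rw [if_neg h, if_neg (mt split_s_inl_eq_inl.1 h)]
      · rw [← (Equiv.subtypeEquivRight (p := fun f => ¬ G.r f ≠ v) (q := fun f => G.r f = v)
          fun f => not_not).sum_comp]
        refine Finset.sum_congr rfl fun f _ => ?_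
        rw [hprod f (not_not.1 f.2)]
        simp only [Sum.elim_inr, Sum.inl.injEq, Subtype.ext_iff,
          Equiv.subtypeEquivRight_apply_coe]
        split_ifs
        · rfl
        · simp

end Unsplit

end Split

theorem split_equiv (R : Type) [CommRing R] {G : DGraph} [Finite G.E] (hns : NoSinks G)
    {v : G.V} (hl : ∀ e, G.s e = v → G.r e ≠ v) (hns' : NoSinks (G.split v hl)) :
    Nonempty (LPA R (G.split v hl) ≃ₐ[R] LPA R G) := by
  classical
  have := Fintype.ofFinite G.E
  have F := isFamily_generators R G hns
  have F' := isFamily_generators R _ hns'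
  have hK := F'.edge_mul_ghost_split
  refine ⟨AlgEquiv.ofAlgHom ((F.split hl).lift R) (F'.unsplit.lift R)
    (algHom_ext ?_ ?_ ?_) (algHom_ext ?_ ?_ ?_)⟩
  · intro x
    by_cases h : x = v
    · subst h
      simp [unsplitVert, F.sum_subtype]
    · simp [unsplitVert, h]
  · intro f
    by_cases h : G.r f = v
    · have : Eq' R G f * Vq R G v = Eq' R G f := by rw [← h, F.er]
      simp [unsplitEdge, h, mul_assoc, ← Finset.mul_sum, F.sum_subtype, this]
    · simp [unsplitEdge, h]
  · intro f
    by_cases h : G.r f = v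
    · have : Vq R G v * Gq R G f = Gq R G f := by rw [← h, F.rg]
      simp [unsplitGhost, h, ← mul_assoc, ← Finset.sum_mul, F.sum_subtype, this]
    · simp [unsplitGhost, h]
  · rintro (x | e)
    · simp [unsplitVert, x.2]
    · simp [unsplitEdge, unsplitGhost, hl e e.2, hK]
  · rintro (f | ⟨f, e⟩)
    · simp [unsplitEdge, f.2]
    · have := F'.er (.inr (f, e))
      simp [unsplitEdge, hl e e.2, f.2, Finset.sum_mul, mul_assoc, F'.ck1, Subtype.val_inj]
      simpa using this
  · rintro (f | ⟨f, e⟩)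
    · simp [unsplitGhost, f.2]
    · have := F'.rg (.inr (f, e))
      simp [unsplitGhost, hl e e.2, f.2, Finset.mul_sum, F'.ck1_assoc, Subtype.val_inj]
      simpa using this

theorem IsCKAlgebra.of_equiv {R : Type} [CommRing R] {A B : Type} [Ring A] [Algebra R A] [Ring B]
    [Algebra R B] (h : IsCKAlgebra R A) (φ : A ≃ₐ[R] B) : IsCKAlgebra R B := by
  obtain ⟨G, hfin, hns, hsrc, ⟨ψ⟩⟩ := h
  exact ⟨G, hfin, hns, hsrc, ⟨ψ.trans φ⟩⟩

/-- Sources emitting a single edge can be absorbed when the edge ends in a set `T` of vertices each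
of which receives an edge from `T`. -/
theorem isCKAlgebra_of_simple_sources (R : Type) [CommRing R] (n : ℕ) :
    ∀ (G : DGraph) (_ : FiniteGraph G) (_ : NoSinks G) (T : Set G.V)
      (_ : ∀ t ∈ T, ∃ f, G.s f ∈ T ∧ G.r f = t)
      (_ : ∀ u ∉ T, (∀ f, G.r f ≠ u) ∧
        ∃ e, G.s e = u ∧ G.r e ∈ T ∧ ∀ e', G.s e' = u → e' = e)
      (_ : Tᶜ.ncard = n), IsCKAlgebra R (LPA R G) := by
  classical
  induction n with
  | zero =>
    intro G hfin hns T hT hS hn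
    have := hfin.1
    have hTuniv : T = Set.univ := by
      rw [Set.ncard_eq_zero] at hn
      exact Set.compl_empty_iff.1 hn
    refine ⟨G, hfin, hns, fun v => ?_, ⟨AlgEquiv.refl⟩⟩
    obtain ⟨f, -, hf⟩ := hT v (hTuniv ▸ Set.mem_univ v)
    exact ⟨f, hf⟩
  | succ n ih =>
    intro G hfin hns T hT hS hn
    have := hfin.1
    have := hfin.2
    obtain ⟨v, hv⟩ : Tᶜ.Nonempty := by
      rw [← Set.ncard_pos, hn]
      omega
    obtain ⟨-, e₀, rfl, he₀T, huniq⟩ := hS v hv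
    obtain ⟨f, hfT, hr⟩ := hT _ he₀T
    have hf : f ≠ e₀ := fun h => hv (h ▸ hfT)
    obtain ⟨φ⟩ := redirect_equiv R hns huniq hf hr
    refine (ih (G.redirect f (G.s e₀)) hfin hns (insert (G.s e₀) T) ?_ ?_ ?_).of_equiv φ.symm
    · rintro t (rfl | ht)
      · exact ⟨f, .inr hfT, redirect_r_self⟩
      · obtain ⟨g, hgT, rfl⟩ := hT t ht
        by_cases hg : g = f
        · exact ⟨e₀, .inl rfl, by rw [redirect_r_of_ne hf.symm, hg, hr]⟩
        · exact ⟨g, .inr hgT, redirect_r_of_ne hg⟩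
    · intro u hu
      rw [Set.mem_insert_iff, not_or] at hu
      obtain ⟨husrc, e, hes, heT, heu⟩ := hS u hu.2
      refine ⟨fun (g : G.E) => ?_, e, hes, ?_, heu⟩
      · by_cases hg : g = f
        · rw [hg, redirect_r_self]
          exact Ne.symm hu.1
        · rw [redirect_r_of_ne hg]
          exact husrc g
      · have : e ≠ f := fun h => hu.2 (hes ▸ h ▸ hfT)
        rw [redirect_r_of_ne this]
        exact .inr heT
    · have : (insert (G.s e₀) T)ᶜ = Tᶜ \ {G.s e₀} := by
        ext x
        simp only [Set.mem_compl_iff, Set.mem_insert_iff, Set.mem_sdiff, Set.mem_singleton_iff]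
        tauto
      rw [this, Set.ncard_sdiff_singleton_of_mem hv, hn, Nat.add_sub_cancel]

/-- The vertices of positive rank, along which the rank strictly decreases, can be split into
sources emitting a single edge. -/
theorem isCKAlgebra_of_rank (R : Type) [CommRing R] (n : ℕ) :
    ∀ (G : DGraph) (_ : FiniteGraph G) (_ : NoSinks G) (T : Set G.V)
      (_ : ∀ t ∈ T, ∃ f, G.s f ∈ T ∧ G.r f = t) (rk : G.V → ℕ)
      (_ : ∀ t ∈ T, rk t = 0) (_ : ∀ e, rk (G.s e) ≠ 0 → rk (G.r e) < rk (G.s e))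
      (_ : ∀ u ∉ T, rk u = 0 → (∀ f, G.r f ≠ u) ∧
        ∃ e, G.s e = u ∧ G.r e ∈ T ∧ ∀ e', G.s e' = u → e' = e)
      (_ : {v | rk v ≠ 0}.ncard = n), IsCKAlgebra R (LPA R G) := by
  classical
  induction n with
  | zero =>
    intro G hfin hns T hT rk _ _ hS hn
    have := hfin.1
    have h0 : ∀ v, rk v = 0 := by
      rw [Set.ncard_eq_zero] at hn
      intro v
      by_contra h
      exact (hn ▸ h : v ∈ (∅ : Set G.V))
    exact isCKAlgebra_of_simple_sources R _ G hfin hns T hT (fun u hu => hS u hu (h0 u)) rfl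
  | succ n ih =>
    intro G hfin hns T hT rk hTrk hrk hS hn
    have := hfin.1
    have := hfin.2
    obtain ⟨v, hv, hmin⟩ : ∃ v, rk v ≠ 0 ∧ ∀ w, rk w ≠ 0 → rk v ≤ rk w := by
      have hne : {v | rk v ≠ 0}.Nonempty := by
        rw [← Set.ncard_pos, hn]
        omega
      obtain ⟨v, hv, h⟩ := Set.exists_min_image _ rk (Set.toFinite _) hne
      exact ⟨v, hv, h⟩
    have hout : ∀ e, G.s e = v → G.r e ∈ T := by
      rintro e rfl
      by_contra h
      have h1 := hrk e hv
      by_cases h0 : rk (G.r e) = 0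
      · exact (hS _ h h0).1 e rfl
      · exact absurd (hmin _ h0) (by omega)
    have hvT : v ∉ T := fun h => hv (hTrk v h)
    have hl : ∀ e, G.s e = v → G.r e ≠ v := fun e he h => hvT (h ▸ hout e he)
    have hns' : NoSinks (G.split v hl) := by
      rintro (x | e)
      · obtain ⟨f, hf⟩ := hns x
        by_cases h : G.r f = v
        · obtain ⟨e, he⟩ := hns v
          exact ⟨.inr (⟨f, h⟩, ⟨e, he⟩), congrArg Sum.inl (Subtype.ext hf)⟩
        · exact ⟨.inl ⟨f, h⟩, split_s_inl_eq_inl.2 hf⟩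
      · exact ⟨.inl ⟨e, hl e e.2⟩, split_s_inl_eq_inr.2 rfl⟩
    obtain ⟨φ⟩ := split_equiv R hns hl hns'
    refine (ih (G.split v hl) ⟨inferInstance, inferInstance⟩ hns'
      {x | ∃ y : {x : G.V // x ≠ v}, y.1 ∈ T ∧ x = .inl y} ?_
      (Sum.elim (fun x => rk x) fun _ => 0) ?_ ?_ ?_ ?_).of_equiv φ
    · rintro _ ⟨t, ht, rfl⟩
      obtain ⟨f, hfT, hf⟩ := hT t ht
      have hfv : G.s f ≠ v := fun h => hvT (h ▸ hfT)
      exact ⟨.inl ⟨f, fun h => t.2 (hf ▸ h)⟩, ⟨⟨G.s f, hfv⟩, hfT, split_s_inl_eq_inl.2 rfl⟩,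
        congrArg Sum.inl (Subtype.ext hf)⟩
    · rintro _ ⟨t, ht, rfl⟩
      exact hTrk t ht
    · rintro (f | ⟨f, e⟩)
      · by_cases h : G.s f = v
        · simp [h]
        · simpa [h] using hrk f
      · intro h
        have h0 : rk (G.r e) = 0 := hTrk _ (hout e e.2)
        simp only [Sum.elim_inr, Sum.elim_inl] at h ⊢
        omega
    · rintro (u | e) hu hu0
      · have huT : u.1 ∉ T := fun h => hu ⟨u, h, rfl⟩
        obtain ⟨hsrc, e, hes, heT, heu⟩ := hS u huT hu0
        have hev : G.r e ≠ v := fun h => hvT (h ▸ heT)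
        refine ⟨?_, .inl ⟨e, hev⟩, split_s_inl_eq_inl.2 hes, ⟨⟨G.r e, hev⟩, heT, rfl⟩, ?_⟩
        · rintro (f | ⟨f, e'⟩) h
          · exact hsrc f (congrArg Subtype.val (Sum.inl.inj h))
          · exact hsrc e' (congrArg Subtype.val (Sum.inl.inj h))
        · rintro (f | ⟨f, e'⟩) h
          · exact congrArg Sum.inl (Subtype.ext (heu f (split_s_inl_eq_inl.1 h)))
          · have := heu f (congrArg Subtype.val (Sum.inl.inj h))
            exact absurd (this ▸ f.2) hev
      · refine ⟨?_, .inl ⟨e, hl e e.2⟩, split_s_inl_eq_inr.2 rfl,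
          ⟨⟨G.r e, hl e e.2⟩, hout e e.2, rfl⟩, ?_⟩
        · rintro (f | ⟨f, e'⟩) h <;> simp at h
        · rintro (f | ⟨f, e'⟩) h
          · exact congrArg Sum.inl (Subtype.ext (split_s_inl_eq_inr.1 h))
          · simp at h
    · rw [← Nat.add_right_cancel_iff (n := 1), ← hn]
      have himg : {x | Sum.elim (fun x : {x : G.V // x ≠ v} => rk x)
          (fun _ : {e : G.E // G.s e = v} => 0) x ≠ 0}
            = (Sum.inl '' (Subtype.val ⁻¹' {x | rk x ≠ 0})) := by
        ext (x | e) <;> simp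
      have hdiff : Subtype.val '' (Subtype.val ⁻¹' {x | rk x ≠ 0} : Set {x : G.V // x ≠ v})
          = {x | rk x ≠ 0} \ {v} := by
        ext x
        simp [and_comm]
      rw [himg, Set.ncard_image_of_injective _ Sum.inl_injective,
        ← Set.ncard_image_of_injective _ Subtype.val_injective, hdiff]
      exact Set.ncard_sdiff_singleton_add_one hv

theorem isCKAlgebra_of_noSinks (R : Type) [CommRing R] (G : DGraph) (hfin : FiniteGraph G)
    (hns : NoSinks G) : IsCKAlgebra R (LPA R G) := by
  classical
  have := hfin.1
  let T : Set G.V := {t | ∃ u, Relation.TransGen (Step G) u u ∧ Relation.TransGen (Step G) u t}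
  have hrefl : ∀ v ∉ T, v ∈ {w | w ∉ T ∧ Reaches G v w} := fun v hv => ⟨hv, .refl⟩
  refine isCKAlgebra_of_rank R _ G hfin hns T ?_
    (fun v => if v ∈ T then 0 else {w | w ∉ T ∧ Reaches G v w}.ncard) ?_ ?_ ?_ rfl
  · rintro t ⟨u, huu, hut⟩
    obtain ⟨x, hux, f, rfl, rfl⟩ := Relation.TransGen.tail'_iff.1 hut
    exact ⟨f, ⟨u, huu, huu.trans_left hux⟩, rfl⟩
  · intro t ht
    simp [ht]
  · intro e he
    have hs : G.s e ∉ T := fun h => he (if_pos h)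
    have hstep : Step G (G.s e) (G.r e) := ⟨e, rfl, rfl⟩
    simp only [if_neg hs]
    split_ifs with hr
    · rw [Set.ncard_pos]
      exact ⟨_, hrefl _ hs⟩
    · refine Set.ncard_lt_ncard ⟨fun w hw => ⟨hw.1, hw.2.head hstep⟩, fun h => ?_⟩
      have hcycle := Relation.TransGen.head' hstep (h (hrefl _ hs)).2
      exact hs ⟨_, hcycle, hcycle⟩
  · intro u hu h0
    rw [if_neg hu, Set.ncard_eq_zero] at h0
    exact absurd (hrefl u hu) (h0 ▸ Set.notMem_empty u)

end DGraph

theorem stmt3 (R : Type) [CommRing R] (G : DGraph) (hfin : FiniteGraph G)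
    (hns : NoSinks G) :
    ∃ G' : DGraph, FiniteGraph G' ∧ NoSinks G' ∧ NoSources G' ∧
      Nonempty (LPA R G ≃ₐ[R] LPA R G') := by
  obtain ⟨G', hfin', hns', hsrc', ⟨φ⟩⟩ := isCKAlgebra_of_noSinks R G hfin hns
  exact ⟨G', hfin', hns', hsrc', ⟨φ.symm⟩⟩
end
end
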